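/- arXiv:2407.14715 — 5 statements merged into one kernel-verified Lean document; each statement's English description precedes it below -/
import Mathlib

section
/- Let 2 ≤ p < ∞ and let γ be a real number with γ > 1/2 − 1/p. Then there exists a constant C > 0 such that for every smooth function u : (0,1] × 𝕋 → ℂ with ‖u‖_{K_γ^1} < ∞, one has ‖u‖_{L^p((0,1]×𝕋)} ≤ C ‖u‖_{K_γ^1}. -/
open MeasureTheory Real Set ENNReal

noncomputable section

/-- The iterated partial derivative `∂_ψ^p ∂_θ^q u` of a function `u(ψ,θ)`. -/
def pder (p q : ℕ) (u : ℝ → ℝ → ℂ) : ℝ → ℝ → ℂ :=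
  fun ψ θ => iteratedDeriv p (fun s => iteratedDeriv q (u s) θ) ψ

/-- The square of the Kondratev norm `‖u‖_{K_γ^m}` on `Π = (0,1] × 𝕋`:
`‖u‖²_{K_γ^m} = Σ_{p+q≤m} ∫₀¹ ∫_𝕋 ψ^(2(p-γ)) |∂_ψ^p ∂_θ^q u(ψ,θ)|² dθ dψ`. -/
def KNormSq (γ : ℝ) (m : ℕ) (u : ℝ → ℝ → ℂ) : ℝ≥0∞ :=
  ∑ p ∈ Finset.range (m+1), ∑ q ∈ Finset.range (m+1-p),
    ∫⁻ ψ in Ioc (0:ℝ) 1, ∫⁻ θ in Ioc (0:ℝ) (2*π),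
      ENNReal.ofReal (ψ ^ (2*((p:ℝ) - γ)) * ‖pder p q u ψ θ‖^2)

/-- The Kondratev norm `‖u‖_{K_γ^m}`. -/
def KNorm (γ : ℝ) (m : ℕ) (u : ℝ → ℝ → ℂ) : ℝ≥0∞ := KNormSq γ m u ^ ((1:ℝ)/2)

/-- `u : (0,1] × 𝕋 → ℂ` is smooth: it is (jointly) smooth for `ψ > 0`
and `2π`-periodic in the angular variable `θ`. -/
def SmoothAnn (u : ℝ → ℝ → ℂ) : Prop :=
  ContDiffOn ℝ (⊤ : ℕ∞) (Function.uncurry u) (Ioi (0:ℝ) ×ˢ (univ : Set ℝ)) ∧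
    ∀ ψ θ, u ψ (θ + 2*π) = u ψ θ

/-- The `L^p` norm of `u` on `(0,1] × 𝕋`. -/
def LpNormAnn (p : ℝ) (u : ℝ → ℝ → ℂ) : ℝ≥0∞ :=
  (∫⁻ ψ in Ioc (0:ℝ) 1, ∫⁻ θ in Ioc (0:ℝ) (2*π), (‖u ψ θ‖₊ : ℝ≥0∞) ^ p) ^ (1/p)

lemma enorm_le_lintegral_add_lintegral_deriv {I : Set ℝ} (hI : I.OrdConnected)
    (h01 : Ioc 0 1 ⊆ I) {f f' : ℝ → ℂ} (hf' : Continuous f')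
    (hd : ∀ x, HasDerivAt f (f' x) x) {x : ℝ} (hx : x ∈ I) :
    ‖f x‖ₑ ≤ (∫⁻ s in I, ‖f s‖ₑ) + ∫⁻ s in I, ‖f' s‖ₑ := by
  have key : ∀ s ∈ I, ‖f x‖ₑ ≤ ‖f s‖ₑ + ∫⁻ s in I, ‖f' s‖ₑ := by
    intro s hs
    have h1 : ∫ y in s..x, f' y = f x - f s :=
      intervalIntegral.integral_eq_sub_of_hasDerivAt (fun y _ => hd y)
        (hf'.intervalIntegrable _ _)
    have h2 : ‖f x - f s‖ₑ ≤ ∫⁻ y in I, ‖f' y‖ₑ := by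
      rw [← h1, ← enorm_norm, intervalIntegral.norm_intervalIntegral_eq, enorm_norm]
      refine (enorm_integral_le_lintegral_enorm _).trans (lintegral_mono_set ?_)
      exact uIoc_subset_uIcc.trans (hI.uIcc_subset hs hx)
    calc ‖f x‖ₑ = ‖f s + (f x - f s)‖ₑ := by ring_nf
      _ ≤ ‖f s‖ₑ + ‖f x - f s‖ₑ := enorm_add_le _ _
      _ ≤ _ := by gcongr
  have hf : Continuous f := continuous_iff_continuousAt.2 fun y => (hd y).continuousAt
  calc ‖f x‖ₑ = ∫⁻ _ in Ioc (0:ℝ) 1, ‖f x‖ₑ := by simp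
    _ ≤ ∫⁻ s in Ioc (0:ℝ) 1, (‖f s‖ₑ + ∫⁻ s in I, ‖f' s‖ₑ) :=
      setLIntegral_mono' measurableSet_Ioc fun s hs => key s (h01 hs)
    _ = (∫⁻ s in Ioc (0:ℝ) 1, ‖f s‖ₑ) + ∫⁻ s in I, ‖f' s‖ₑ := by
      rw [lintegral_add_left hf.enorm.measurable]; simp
    _ ≤ _ := by gcongr

/-- The Sobolev inequality `W^{1,1} ⊆ L²` on a product of two intervals. -/
lemma lintegral_enorm_sq_le {I J : Set ℝ} (hI : I.OrdConnected) (hJ : J.OrdConnected)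
    (hI01 : Ioc 0 1 ⊆ I) (hJ01 : Ioc 0 1 ⊆ J) {g g₁ g₂ : ℝ → ℝ → ℂ}
    (hg : Continuous (Function.uncurry g)) (hg₁ : Continuous (Function.uncurry g₁))
    (hg₂ : Continuous (Function.uncurry g₂))
    (hd₁ : ∀ t θ, HasDerivAt (fun s => g s θ) (g₁ t θ) t)
    (hd₂ : ∀ t θ, HasDerivAt (g t) (g₂ t θ) θ) :
    ∫⁻ z, ‖g z.1 z.2‖ₑ ^ 2 ∂((volume.restrict I).prod (volume.restrict J)) ≤
      (∫⁻ z, (‖g z.1 z.2‖ₑ + ‖g₁ z.1 z.2‖ₑ)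
          ∂((volume.restrict I).prod (volume.restrict J))) *
        ∫⁻ z, (‖g z.1 z.2‖ₑ + ‖g₂ z.1 z.2‖ₑ)
          ∂((volume.restrict I).prod (volume.restrict J)) := by
  have mg : Measurable fun z : ℝ × ℝ => ‖g z.1 z.2‖ₑ := hg.enorm.measurable
  have mg₁ : Measurable fun z : ℝ × ℝ => ‖g₁ z.1 z.2‖ₑ := hg₁.enorm.measurable
  have mg₂ : Measurable fun z : ℝ × ℝ => ‖g₂ z.1 z.2‖ₑ := hg₂.enorm.measurable
  set A : ℝ → ℝ≥0∞ := fun θ => ∫⁻ s in I, (‖g s θ‖ₑ + ‖g₁ s θ‖ₑ) with hA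
  set B : ℝ → ℝ≥0∞ := fun t => ∫⁻ s in J, (‖g t s‖ₑ + ‖g₂ t s‖ₑ) with hB
  have mA : Measurable A := (mg.add mg₁).lintegral_prod_left'
  have mB : Measurable B := (mg.add mg₂).lintegral_prod_right'
  have hgA : ∀ t ∈ I, ∀ θ, ‖g t θ‖ₑ ≤ A θ := by
    intro t ht θ
    rw [hA]
    simp only
    rw [lintegral_add_left (f := fun s => ‖g s θ‖ₑ)
      (mg.comp (measurable_id.prodMk measurable_const))]
    exact enorm_le_lintegral_add_lintegral_deriv hI hI01
      (f' := fun s => g₁ s θ) (by exact hg₁.comp (by fun_prop : Continuous fun s : ℝ => (s, θ)))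
      (fun s => hd₁ s θ) ht
  have hgB : ∀ t, ∀ θ ∈ J, ‖g t θ‖ₑ ≤ B t := by
    intro t θ hθ
    rw [hB]
    simp only
    rw [lintegral_add_left (f := fun s => ‖g t s‖ₑ)
      (mg.comp (measurable_const.prodMk measurable_id))]
    exact enorm_le_lintegral_add_lintegral_deriv hJ hJ01
      (f' := fun s => g₂ t s) (by exact hg₂.comp (by fun_prop : Continuous fun s : ℝ => (t, s)))
      (fun s => hd₂ t s) hθ
  have e1 : ∫⁻ z, (‖g z.1 z.2‖ₑ + ‖g₁ z.1 z.2‖ₑ)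
      ∂((volume.restrict I).prod (volume.restrict J)) = ∫⁻ θ in J, A θ :=
    lintegral_prod_symm' _ (mg.add mg₁)
  have e2 : ∫⁻ z, (‖g z.1 z.2‖ₑ + ‖g₂ z.1 z.2‖ₑ)
      ∂((volume.restrict I).prod (volume.restrict J)) = ∫⁻ t in I, B t :=
    lintegral_prod _ (mg.add mg₂).aemeasurable
  rw [e1, e2, lintegral_prod _ (mg.pow_const 2).aemeasurable,
    ← lintegral_const_mul _ mB]
  refine setLIntegral_mono' hI.measurableSet fun t ht => ?_
  rw [← lintegral_mul_const _ mA]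
  refine setLIntegral_mono' hJ.measurableSet fun θ hθ => ?_
  rw [sq]
  exact mul_le_mul' (hgA t ht θ) (hgB t θ hθ)

lemma lintegral_mul_sq_le {α : Type*} [MeasurableSpace α] (μ : Measure α) {f g : α → ℝ≥0∞}
    (hf : Measurable f) (hg : Measurable g) :
    (∫⁻ a, f a * g a ∂μ) ^ 2 ≤ (∫⁻ a, f a ^ 2 ∂μ) * ∫⁻ a, g a ^ 2 ∂μ := by
  have h := ENNReal.lintegral_mul_le_Lp_mul_Lq μ Real.HolderConjugate.two_two
    hf.aemeasurable hg.aemeasurable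
  calc _ ≤ _ := pow_le_pow_left₀ zero_le h 2
    _ = _ := by
      rw [mul_pow, ← ENNReal.rpow_natCast, ← ENNReal.rpow_natCast, ← ENNReal.rpow_mul,
        ← ENNReal.rpow_mul]
      norm_num

lemma ENNReal.add_natCast_mul_sq_le (n : ℕ) (hn : 1 ≤ n) (a b : ℝ≥0∞) :
    (a + n * b) ^ 2 ≤ 2 * n ^ 2 * (a ^ 2 + b ^ 2) := by
  have hn' : (1 : ℝ≥0∞) ≤ n := by exact_mod_cast hn
  have h2 : ∀ a b : ℝ≥0∞, (a + b) ^ 2 ≤ 2 * (a ^ 2 + b ^ 2) := by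
    intro a b
    have := ENNReal.rpow_add_le_mul_rpow_add_rpow a b (p := 2) (by norm_num)
    norm_num at this
    exact_mod_cast this
  calc (a + n * b) ^ 2 ≤ (n * a + n * b) ^ 2 := by
        gcongr
        exact le_mul_of_one_le_left' hn'
    _ = n ^ 2 * (a + b) ^ 2 := by ring
    _ ≤ n ^ 2 * (2 * (a ^ 2 + b ^ 2)) := by gcongr; exact h2 a b
    _ = _ := by ring

lemma lintegral_pow_mul_add_sq_le {α : Type*} [MeasurableSpace α] (μ : Measure α)
    {f g : α → ℝ≥0∞} (hf : Measurable f) (hg : Measurable g) (n : ℕ) :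
    (∫⁻ a, (f a ^ (n + 1) + (n + 1 : ℕ) * f a ^ n * g a) ∂μ) ^ 2 ≤
      2 * (n + 1 : ℕ) ^ 2 * (∫⁻ a, f a ^ (2 * n) ∂μ) * ∫⁻ a, (f a ^ 2 + g a ^ 2) ∂μ := by
  calc (∫⁻ a, (f a ^ (n + 1) + (n + 1 : ℕ) * f a ^ n * g a) ∂μ) ^ 2
      = (∫⁻ a, f a ^ n * (f a + (n + 1 : ℕ) * g a) ∂μ) ^ 2 := by
        congr 2; ext a; ring
    _ ≤ (∫⁻ a, (f a ^ n) ^ 2 ∂μ) * ∫⁻ a, (f a + (n + 1 : ℕ) * g a) ^ 2 ∂μ :=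
        lintegral_mul_sq_le μ (by fun_prop) (by fun_prop)
    _ ≤ (∫⁻ a, f a ^ (2 * n) ∂μ) *
          ∫⁻ a, 2 * (n + 1 : ℕ) ^ 2 * (f a ^ 2 + g a ^ 2) ∂μ := by
        refine mul_le_mul' (le_of_eq ?_) (lintegral_mono fun a =>
          ENNReal.add_natCast_mul_sq_le _ (by simp) _ _)
        congr 1; ext a; ring
    _ = _ := by
        rw [lintegral_const_mul _ (by fun_prop)]; ring

lemma lintegral_enorm_pow_le {I J : Set ℝ} (hI : I.OrdConnected) (hJ : J.OrdConnected)
    (hI01 : Ioc 0 1 ⊆ I) (hJ01 : Ioc 0 1 ⊆ J) (n : ℕ) :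
    ∃ A : NNReal, ∀ {w w₁ w₂ : ℝ → ℝ → ℂ}, Continuous (Function.uncurry w) →
      Continuous (Function.uncurry w₁) → Continuous (Function.uncurry w₂) →
      (∀ t θ, HasDerivAt (fun s => w s θ) (w₁ t θ) t) →
      (∀ t θ, HasDerivAt (w t) (w₂ t θ) θ) →
      ∫⁻ z, ‖w z.1 z.2‖ₑ ^ (2 * (n + 1)) ∂((volume.restrict I).prod (volume.restrict J)) ≤
        A * (∫⁻ z, (‖w z.1 z.2‖ₑ ^ 2 + ‖w₁ z.1 z.2‖ₑ ^ 2 + ‖w₂ z.1 z.2‖ₑ ^ 2)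
          ∂((volume.restrict I).prod (volume.restrict J))) ^ (n + 1) := by
  induction n with
  | zero =>
    refine ⟨1, fun {w w₁ w₂} _ _ _ _ _ => ?_⟩
    simp only [zero_add, mul_one, pow_one, ENNReal.coe_one, one_mul]
    exact lintegral_mono fun z => by rw [add_assoc]; exact le_self_add
  | succ n ih =>
    obtain ⟨A, hA⟩ := ih
    refine ⟨2 * ((n + 1 + 1 : ℕ) : NNReal) ^ 2 * A, fun {w w₁ w₂} hw hw₁ hw₂ hd₁ hd₂ => ?_⟩
    have hE := hA hw hw₁ hw₂ hd₁ hd₂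
    set μ := (volume.restrict I).prod (volume.restrict J)
    set H := ∫⁻ z, (‖w z.1 z.2‖ₑ ^ 2 + ‖w₁ z.1 z.2‖ₑ ^ 2 + ‖w₂ z.1 z.2‖ₑ ^ 2) ∂μ
    set E := ∫⁻ z, ‖w z.1 z.2‖ₑ ^ (2 * (n + 1)) ∂μ
    have mw : Measurable fun z : ℝ × ℝ => ‖w z.1 z.2‖ₑ := hw.enorm.measurable
    have mw₁ : Measurable fun z : ℝ × ℝ => ‖w₁ z.1 z.2‖ₑ := hw₁.enorm.measurable
    have mw₂ : Measurable fun z : ℝ × ℝ => ‖w₂ z.1 z.2‖ₑ := hw₂.enorm.measurable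
    have hs := lintegral_enorm_sq_le hI hJ hI01 hJ01
      (g := fun t θ => w t θ ^ (n + 1 + 1))
      (g₁ := fun t θ => ((n + 1 + 1 : ℕ) : ℂ) * w t θ ^ (n + 1) * w₁ t θ)
      (g₂ := fun t θ => ((n + 1 + 1 : ℕ) : ℂ) * w t θ ^ (n + 1) * w₂ t θ)
      (hw.pow _) ((continuous_const.mul (hw.pow _)).mul hw₁)
      ((continuous_const.mul (hw.pow _)).mul hw₂)
      (fun t θ => (hd₁ t θ).pow _) (fun t θ => (hd₂ t θ).pow _)
    have hen : ∀ m : ℕ, ‖(m : ℂ)‖ₑ = m := fun m => by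
      rw [← ofReal_norm, Complex.norm_natCast, ENNReal.ofReal_natCast]
    simp only [enorm_pow, enorm_mul, hen] at hs
    set P := ∫⁻ z, (‖w z.1 z.2‖ₑ ^ (n + 1 + 1) +
      ((n + 1 + 1 : ℕ) : ℝ≥0∞) * ‖w z.1 z.2‖ₑ ^ (n + 1) * ‖w₁ z.1 z.2‖ₑ) ∂μ
    set Q := ∫⁻ z, (‖w z.1 z.2‖ₑ ^ (n + 1 + 1) +
      ((n + 1 + 1 : ℕ) : ℝ≥0∞) * ‖w z.1 z.2‖ₑ ^ (n + 1) * ‖w₂ z.1 z.2‖ₑ) ∂μ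
    have hP : P ^ 2 ≤ 2 * (n + 1 + 1 : ℕ) ^ 2 * E * H := by
      refine (lintegral_pow_mul_add_sq_le μ mw mw₁ (n + 1)).trans ?_
      gcongr
      exact lintegral_mono fun z => le_self_add
    have hQ : Q ^ 2 ≤ 2 * (n + 1 + 1 : ℕ) ^ 2 * E * H := by
      refine (lintegral_pow_mul_add_sq_le μ mw mw₂ (n + 1)).trans ?_
      gcongr
      exact lintegral_mono fun z => by
        rw [add_right_comm]; exact le_self_add
    have hPQ : P * Q ≤ 2 * (n + 1 + 1 : ℕ) ^ 2 * E * H := by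
      rcases le_total P Q with h | h
      · exact (mul_le_mul_left h Q).trans (by rwa [← sq])
      · exact (mul_le_mul_right h P).trans (by rwa [← sq])
    calc _ = ∫⁻ z, (‖w z.1 z.2‖ₑ ^ (n + 1 + 1)) ^ 2 ∂μ := by
          congr 1; ext z; ring
      _ ≤ P * Q := hs
      _ ≤ 2 * (n + 1 + 1 : ℕ) ^ 2 * E * H := hPQ
      _ ≤ 2 * (n + 1 + 1 : ℕ) ^ 2 * (A * H ^ (n + 1)) * H := by gcongr
      _ = _ := by push_cast; ring

/-- The Sobolev embedding `H¹ ⊆ L^p` on a product of two intervals. -/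
lemma lintegral_enorm_rpow_le {I J : Set ℝ} (hI : I.OrdConnected) (hJ : J.OrdConnected)
    (hI01 : Ioc 0 1 ⊆ I) (hJ01 : Ioc 0 1 ⊆ J) {p : ℝ} (hp : 2 ≤ p) :
    ∃ A : NNReal, ∀ {w w₁ w₂ : ℝ → ℝ → ℂ}, Continuous (Function.uncurry w) →
      Continuous (Function.uncurry w₁) → Continuous (Function.uncurry w₂) →
      (∀ t θ, HasDerivAt (fun s => w s θ) (w₁ t θ) t) →
      (∀ t θ, HasDerivAt (w t) (w₂ t θ) θ) →
      ∫⁻ z, ‖w z.1 z.2‖ₑ ^ p ∂((volume.restrict I).prod (volume.restrict J)) ≤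
        A * (∫⁻ z, (‖w z.1 z.2‖ₑ ^ 2 + ‖w₁ z.1 z.2‖ₑ ^ 2 + ‖w₂ z.1 z.2‖ₑ ^ 2)
          ∂((volume.restrict I).prod (volume.restrict J))) ^ (p / 2) := by
  obtain ⟨n, hn⟩ := exists_nat_ge (p / 2)
  have hn0 : (0 : ℝ) < n := by linarith
  obtain ⟨A, hA⟩ := lintegral_enorm_pow_le hI hJ hI01 hJ01 n
  set s : ℝ := (p / 2 - 1) / n with hs
  have hs0 : 0 ≤ s := div_nonneg (by linarith) hn0.le
  have hs1 : 0 ≤ 1 - s := by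
    rw [sub_nonneg, hs, div_le_one hn0]; linarith
  have hsn : s * n = p / 2 - 1 := by rw [hs]; field_simp
  refine ⟨A ^ s, fun {w w₁ w₂} hw hw₁ hw₂ hd₁ hd₂ => ?_⟩
  have hE := hA hw hw₁ hw₂ hd₁ hd₂
  set μ := (volume.restrict I).prod (volume.restrict J)
  set H := ∫⁻ z, (‖w z.1 z.2‖ₑ ^ 2 + ‖w₁ z.1 z.2‖ₑ ^ 2 + ‖w₂ z.1 z.2‖ₑ ^ 2) ∂μ
  have mw : Measurable fun z : ℝ × ℝ => ‖w z.1 z.2‖ₑ := hw.enorm.measurable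
  have h1 : ∫⁻ z, ‖w z.1 z.2‖ₑ ^ 2 ∂μ ≤ H :=
    lintegral_mono fun z => by rw [add_assoc]; exact le_self_add
  calc ∫⁻ z, ‖w z.1 z.2‖ₑ ^ p ∂μ
      = ∫⁻ z, (‖w z.1 z.2‖ₑ ^ 2) ^ (1 - s) * (‖w z.1 z.2‖ₑ ^ (2 * (n + 1))) ^ s ∂μ := by
        congr 1; ext z
        rw [← ENNReal.rpow_natCast, ← ENNReal.rpow_natCast, ← ENNReal.rpow_mul,
          ← ENNReal.rpow_mul, ← ENNReal.rpow_add_of_nonneg _ _ (by positivity) (by positivity)]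
        congr 1; push_cast; linear_combination -2 * hsn
    _ ≤ (∫⁻ z, ‖w z.1 z.2‖ₑ ^ 2 ∂μ) ^ (1 - s) *
          (∫⁻ z, ‖w z.1 z.2‖ₑ ^ (2 * (n + 1)) ∂μ) ^ s :=
        ENNReal.lintegral_mul_norm_pow_le (by fun_prop) (by fun_prop) hs1 hs0 (by ring)
    _ ≤ H ^ (1 - s) * (A * H ^ (n + 1)) ^ s := by gcongr
    _ = _ := by
        rw [ENNReal.mul_rpow_of_nonneg _ _ hs0, ← ENNReal.rpow_natCast, ← ENNReal.rpow_mul,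
          mul_left_comm, ← ENNReal.rpow_add_of_nonneg _ _ hs1 (by positivity),
          ENNReal.coe_rpow_of_nonneg _ hs0]
        congr 2; push_cast; linear_combination hsn

lemma lintegral_Ioc_zero_one_eq_lintegral_exp_neg (F : ℝ → ℝ≥0∞) :
    ∫⁻ ψ in Ioc (0:ℝ) 1, F ψ =
      ∫⁻ t in Ici (0:ℝ), ENNReal.ofReal (rexp (-t)) * F (rexp (-t)) := by
  have him : (fun t : ℝ => rexp (-t)) '' Ici 0 = Ioc 0 1 := by
    ext y
    constructor
    · rintro ⟨t, ht, rfl⟩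
      exact ⟨exp_pos _, by simpa using ht⟩
    · rintro ⟨h0, h1⟩
      exact ⟨-log y, by simpa using log_nonpos h0.le h1, by simp [exp_log h0]⟩
  rw [← him, lintegral_image_eq_lintegral_abs_deriv_mul measurableSet_Ici
    (f' := fun t => -rexp (-t))
    (fun t _ => by simpa using ((hasDerivAt_neg t).exp).hasDerivWithinAt)
    (fun a _ b _ h => by simpa using h)]
  simp [abs_of_pos (exp_pos _)]

lemma enorm_add_sq_le (a b : ℂ) : ‖a + b‖ₑ ^ 2 ≤ 2 * ‖a‖ₑ ^ 2 + 2 * ‖b‖ₑ ^ 2 := by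
  calc ‖a + b‖ₑ ^ 2 ≤ (‖a‖ₑ + (1 : ℕ) * ‖b‖ₑ) ^ 2 := by
        gcongr; simpa using enorm_add_le a b
    _ ≤ 2 * (1 : ℕ) ^ 2 * (‖a‖ₑ ^ 2 + ‖b‖ₑ ^ 2) := ENNReal.add_natCast_mul_sq_le 1 le_rfl _ _
    _ = _ := by push_cast; ring

lemma enorm_exp_smul_sq (x : ℝ) (z : ℂ) :
    ‖rexp x • z‖ₑ ^ 2 = ENNReal.ofReal (rexp (2 * x)) * ‖z‖ₑ ^ 2 := by
  rw [enorm_smul, mul_pow, Real.enorm_of_nonneg (exp_pos x).le,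
    ← ENNReal.ofReal_pow (exp_pos x).le, ← Real.exp_nat_mul]
  norm_num

lemma ofReal_rpow_mul_norm_sq (t a : ℝ) (z : ℂ) :
    ENNReal.ofReal (rexp (-t)) * ENNReal.ofReal (rexp (-t) ^ a * ‖z‖ ^ 2) =
      ENNReal.ofReal (rexp (-t * (a + 1))) * ‖z‖ₑ ^ 2 := by
  rw [← Real.exp_mul, ENNReal.ofReal_mul (exp_pos _).le, ← mul_assoc,
    ← ENNReal.ofReal_mul (exp_pos _).le, ← Real.exp_add, ENNReal.ofReal_pow (norm_nonneg _),
    ofReal_norm]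
  ring_nf

/-- The function `u` in the coordinates `(t, θ)`, `ψ = exp (-t)`, weighted by `ψ ^ (-δ)`. -/
def logPullback (δ : ℝ) (u : ℝ → ℝ → ℂ) (t θ : ℝ) : ℂ :=
  rexp (δ * t) • u (rexp (-t)) θ

/-- The `t`-derivative of `logPullback δ u`. -/
def logPullbackDeriv₁ (δ : ℝ) (u : ℝ → ℝ → ℂ) (t θ : ℝ) : ℂ :=
  δ • logPullback δ u t θ +
    -(rexp ((δ - 1) * t) • fderiv ℝ (Function.uncurry u) (rexp (-t), θ) (1, 0))

/-- The `θ`-derivative of `logPullback δ u`. -/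
def logPullbackDeriv₂ (δ : ℝ) (u : ℝ → ℝ → ℂ) (t θ : ℝ) : ℂ :=
  rexp (δ * t) • fderiv ℝ (Function.uncurry u) (rexp (-t), θ) (0, 1)

namespace SmoothAnn

variable {u : ℝ → ℝ → ℂ}

lemma hasFDerivAt (hu : SmoothAnn u) {ψ : ℝ} (hψ : 0 < ψ) (θ : ℝ) :
    HasFDerivAt (Function.uncurry u) (fderiv ℝ (Function.uncurry u) (ψ, θ)) (ψ, θ) :=
  ((hu.1.differentiableOn (by simp)).differentiableAt
    ((isOpen_Ioi.prod isOpen_univ).mem_nhds (mk_mem_prod hψ (mem_univ θ)))).hasFDerivAt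

lemma hasDerivAt₁ (hu : SmoothAnn u) {ψ : ℝ} (hψ : 0 < ψ) (θ : ℝ) :
    HasDerivAt (fun s => u s θ) (fderiv ℝ (Function.uncurry u) (ψ, θ) (1, 0)) ψ :=
  (hu.hasFDerivAt hψ θ).comp_hasDerivAt (f := fun s => (s, θ)) ψ
    ((hasDerivAt_id ψ).prodMk (hasDerivAt_const ψ θ))

lemma hasDerivAt₂ (hu : SmoothAnn u) {ψ : ℝ} (hψ : 0 < ψ) (θ : ℝ) :
    HasDerivAt (u ψ) (fderiv ℝ (Function.uncurry u) (ψ, θ) (0, 1)) θ :=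
  (hu.hasFDerivAt hψ θ).comp_hasDerivAt (f := fun s => (ψ, s)) θ
    ((hasDerivAt_const θ ψ).prodMk (hasDerivAt_id θ))

lemma pder_one_zero (hu : SmoothAnn u) {ψ : ℝ} (hψ : 0 < ψ) (θ : ℝ) :
    pder 1 0 u ψ θ = fderiv ℝ (Function.uncurry u) (ψ, θ) (1, 0) := by
  simpa [pder, iteratedDeriv_one] using (hu.hasDerivAt₁ hψ θ).deriv

lemma pder_zero_one (hu : SmoothAnn u) {ψ : ℝ} (hψ : 0 < ψ) (θ : ℝ) :
    pder 0 1 u ψ θ = fderiv ℝ (Function.uncurry u) (ψ, θ) (0, 1) := by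
  simpa [pder, iteratedDeriv_one] using (hu.hasDerivAt₂ hψ θ).deriv

lemma continuous_exp_neg (hu : SmoothAnn u) :
    Continuous fun z : ℝ × ℝ => u (rexp (-z.1)) z.2 :=
  hu.1.continuousOn.comp_continuous (f := fun z : ℝ × ℝ => (rexp (-z.1), z.2)) (by fun_prop)
    fun z => ⟨exp_pos _, mem_univ _⟩

lemma continuous_fderiv_exp_neg (hu : SmoothAnn u) (v : ℝ × ℝ) :
    Continuous fun z : ℝ × ℝ => fderiv ℝ (Function.uncurry u) (rexp (-z.1), z.2) v := by
  have h := hu.1.continuousOn_fderiv_of_isOpen (isOpen_Ioi.prod isOpen_univ) (by simp)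
  exact (h.comp_continuous (f := fun z : ℝ × ℝ => (rexp (-z.1), z.2)) (by fun_prop)
    fun z => ⟨exp_pos _, mem_univ _⟩).clm_apply continuous_const

lemma continuous_logPullback (hu : SmoothAnn u) (δ : ℝ) :
    Continuous (Function.uncurry (logPullback δ u)) :=
  (by fun_prop : Continuous fun z : ℝ × ℝ => rexp (δ * z.1)).smul hu.continuous_exp_neg

lemma continuous_logPullbackDeriv₁ (hu : SmoothAnn u) (δ : ℝ) :
    Continuous (Function.uncurry (logPullbackDeriv₁ δ u)) :=
  ((hu.continuous_logPullback δ).const_smul δ).add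
    ((by fun_prop : Continuous fun z : ℝ × ℝ => rexp ((δ - 1) * z.1)).smul
      (hu.continuous_fderiv_exp_neg (1, 0))).neg

lemma continuous_logPullbackDeriv₂ (hu : SmoothAnn u) (δ : ℝ) :
    Continuous (Function.uncurry (logPullbackDeriv₂ δ u)) :=
  (by fun_prop : Continuous fun z : ℝ × ℝ => rexp (δ * z.1)).smul
    (hu.continuous_fderiv_exp_neg (0, 1))

lemma hasDerivAt_logPullback₁ (hu : SmoothAnn u) (δ t θ : ℝ) :
    HasDerivAt (fun s => logPullback δ u s θ) (logPullbackDeriv₁ δ u t θ) t := by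
  have h1 : HasDerivAt (fun s : ℝ => rexp (δ * s)) (rexp (δ * t) * δ) t := by
    simpa using ((hasDerivAt_id t).const_mul δ).exp
  have h2 : HasDerivAt (fun s : ℝ => rexp (-s)) (-rexp (-t)) t := by
    simpa using (hasDerivAt_neg t).exp
  have h3 := h1.smul ((hu.hasDerivAt₁ (exp_pos (-t)) θ).scomp t h2)
  refine h3.congr_deriv ?_
  simp only [logPullbackDeriv₁, logPullback, Function.comp_apply, neg_smul, smul_neg, smul_smul,
    ← Real.exp_add]
  rw [add_comm, mul_comm δ]
  ring_nf

lemma hasDerivAt_logPullback₂ (hu : SmoothAnn u) (δ t θ : ℝ) :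
    HasDerivAt (logPullback δ u t) (logPullbackDeriv₂ δ u t θ) θ :=
  (hu.hasDerivAt₂ (exp_pos (-t)) θ).const_smul (rexp (δ * t))

lemma lintegral_enorm_rpow_le_logPullback (hu : SmoothAnn u) {p δ : ℝ} (hp : 0 ≤ p)
    (hδ : 0 ≤ 1 + δ * p) :
    ∫⁻ ψ in Ioc (0:ℝ) 1, ∫⁻ θ in Ioc (0:ℝ) (2*π), (‖u ψ θ‖₊ : ℝ≥0∞) ^ p ≤
      ∫⁻ z, ‖logPullback δ u z.1 z.2‖ₑ ^ p
        ∂((volume.restrict (Ici (0:ℝ))).prod (volume.restrict (Ioc (0:ℝ) (2*π)))) := by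
  have m : Measurable fun z : ℝ × ℝ => ‖logPullback δ u z.1 z.2‖ₑ :=
    (hu.continuous_logPullback δ).enorm.measurable
  rw [lintegral_Ioc_zero_one_eq_lintegral_exp_neg,
    lintegral_prod _ (m.pow_const p).aemeasurable]
  refine setLIntegral_mono' measurableSet_Ici fun t ht => ?_
  rw [← lintegral_const_mul' _ _ ENNReal.ofReal_ne_top]
  refine lintegral_mono fun θ => ?_
  simp only [logPullback, enorm_smul]
  rw [ENNReal.mul_rpow_of_nonneg _ _ hp, Real.enorm_of_nonneg (exp_pos _).le,
    ENNReal.ofReal_rpow_of_nonneg (exp_pos _).le hp, ← Real.exp_mul]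
  refine mul_le_mul' (ENNReal.ofReal_le_ofReal (exp_le_exp.2 ?_)) le_rfl
  nlinarith [mul_nonneg hδ (mem_Ici.1 ht)]

lemma KNormSq_one_eq (hu : SmoothAnn u) (γ : ℝ) :
    KNormSq γ 1 u =
      ∫⁻ z, (‖logPullback (γ - 1/2) u z.1 z.2‖ₑ ^ 2 + ‖logPullbackDeriv₂ (γ - 1/2) u z.1 z.2‖ₑ ^ 2 +
        ‖rexp ((γ - 1/2 - 1) * z.1) •
          fderiv ℝ (Function.uncurry u) (rexp (-z.1), z.2) (1, 0)‖ₑ ^ 2)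
        ∂((volume.restrict (Ici (0:ℝ))).prod (volume.restrict (Ioc (0:ℝ) (2*π)))) := by
  have m₀ : Measurable fun z : ℝ × ℝ => ‖logPullback (γ - 1/2) u z.1 z.2‖ₑ :=
    (hu.continuous_logPullback _).enorm.measurable
  have m₂ : Measurable fun z : ℝ × ℝ => ‖logPullbackDeriv₂ (γ - 1/2) u z.1 z.2‖ₑ :=
    (hu.continuous_logPullbackDeriv₂ _).enorm.measurable
  have m₁ : Measurable fun z : ℝ × ℝ => ‖rexp ((γ - 1/2 - 1) * z.1) •
      fderiv ℝ (Function.uncurry u) (rexp (-z.1), z.2) (1, 0)‖ₑ :=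
    ((by fun_prop : Continuous fun z : ℝ × ℝ => rexp ((γ - 1/2 - 1) * z.1)).smul
      (hu.continuous_fderiv_exp_neg (1, 0))).enorm.measurable
  rw [lintegral_add_right _ (m₁.pow_const 2), lintegral_add_right _ (m₂.pow_const 2),
    lintegral_prod _ (m₀.pow_const 2).aemeasurable, lintegral_prod _ (m₂.pow_const 2).aemeasurable,
    lintegral_prod _ (m₁.pow_const 2).aemeasurable]
  have h00 : pder 0 0 u = u := by ext; simp [pder]
  have e₀ : ∀ t : ℝ, -t * (2 * (((0:ℕ):ℝ) - γ) + 1) = 2 * ((γ - 1/2) * t) := fun t => by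
    push_cast; ring
  have e₁ : ∀ t : ℝ, -t * (2 * (((1:ℕ):ℝ) - γ) + 1) = 2 * ((γ - 1/2 - 1) * t) := fun t => by
    push_cast; ring
  simp only [KNormSq, Finset.sum_range_succ, Finset.sum_range_zero, zero_add,
    lintegral_Ioc_zero_one_eq_lintegral_exp_neg, Nat.reduceAdd, Nat.reduceSub, Nat.sub_zero]
  simp_rw [← lintegral_const_mul' _ _ (ENNReal.ofReal_ne_top), ofReal_rpow_mul_norm_sq,
    hu.pder_one_zero (exp_pos _), hu.pder_zero_one (exp_pos _), logPullback, logPullbackDeriv₂,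
    enorm_exp_smul_sq]
  simp only [h00, e₀, e₁]

lemma lintegral_logPullback_le (hu : SmoothAnn u) (γ : ℝ) :
    ∫⁻ z, (‖logPullback (γ - 1/2) u z.1 z.2‖ₑ ^ 2 + ‖logPullbackDeriv₁ (γ - 1/2) u z.1 z.2‖ₑ ^ 2 +
        ‖logPullbackDeriv₂ (γ - 1/2) u z.1 z.2‖ₑ ^ 2)
        ∂((volume.restrict (Ici (0:ℝ))).prod (volume.restrict (Ioc (0:ℝ) (2*π)))) ≤
      ((2 * ‖γ - 1/2‖₊ ^ 2 + 3 : NNReal) : ℝ≥0∞) * KNormSq γ 1 u := by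
  rw [hu.KNormSq_one_eq, ← lintegral_const_mul' _ _ ENNReal.coe_ne_top]
  refine lintegral_mono fun z => ?_
  have h := enorm_add_sq_le ((γ - 1/2) • logPullback (γ - 1/2) u z.1 z.2)
    (-(rexp ((γ - 1/2 - 1) * z.1) •
      fderiv ℝ (Function.uncurry u) (rexp (-z.1), z.2) (1, 0)))
  rw [enorm_neg, enorm_smul (γ - 1/2)] at h
  simp only
  set a := ‖logPullback (γ - 1/2) u z.1 z.2‖ₑ
  set b := ‖rexp ((γ - 1/2 - 1) * z.1) •
      fderiv ℝ (Function.uncurry u) (rexp (-z.1), z.2) (1, 0)‖ₑ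
  set c := ‖logPullbackDeriv₂ (γ - 1/2) u z.1 z.2‖ₑ
  set d : ℝ≥0∞ := ‖γ - 1/2‖ₑ
  have hC : ((2 * ‖γ - 1/2‖₊ ^ 2 + 3 : NNReal) : ℝ≥0∞) = 2 * d ^ 2 + 3 := by
    push_cast; rfl
  rw [hC]
  calc _ ≤ a ^ 2 + (2 * (d * a) ^ 2 + 2 * b ^ 2) + c ^ 2 := by gcongr; exact h
    _ ≤ a ^ 2 + (2 * (d * a) ^ 2 + 2 * b ^ 2) + c ^ 2 +
        (2 * a ^ 2 + 2 * c ^ 2 + b ^ 2 + 2 * d ^ 2 * (b ^ 2 + c ^ 2)) := le_self_add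
    _ = _ := by ring

end SmoothAnn

/-- **Embedding `K_γ^1(Π) ⊂ L^p(Π)`** for `2 ≤ p < ∞` and `γ > 1/2 - 1/p`:
there is `C > 0` with `‖u‖_{L^p} ≤ C ‖u‖_{K_γ^1}` for all smooth `u` of finite
Kondratev norm. -/
theorem kondratev_embedding_Lp (p : ℝ) (hp : 2 ≤ p) (γ : ℝ) (hγ : 1/2 - 1/p < γ) :
    ∃ C > 0, ∀ u : ℝ → ℝ → ℂ, SmoothAnn u → KNorm γ 1 u ≠ ⊤ →
      LpNormAnn p u ≤ ENNReal.ofReal C * KNorm γ 1 u := by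
  obtain ⟨A, hA⟩ := lintegral_enorm_rpow_le (ordConnected_Ici (a := (0:ℝ)))
    (ordConnected_Ioc : (Ioc (0:ℝ) (2 * π)).OrdConnected)
    (fun x hx => hx.1.le) (fun x hx => ⟨hx.1, hx.2.trans (by linarith [pi_gt_three])⟩) hp
  have hp0 : 0 < p := by linarith
  set δ : ℝ := γ - 1 / 2 with hδ
  have hpδ : 0 ≤ 1 + δ * p := by
    have : 1 / 2 - 1 / p < δ + 1 / 2 := by rw [hδ]; linarith
    have h2 : -(1 / p) * p ≤ δ * p := by gcongr; linarith
    have h3 : -(1 / p) * p = -1 := by field_simp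
    linarith
  set C₀ : NNReal := 2 * ‖δ‖₊ ^ 2 + 3
  refine ⟨(A ^ (1 / p) * C₀ ^ (1 / 2 : ℝ) : NNReal) + 1, by positivity, fun u hu _ => ?_⟩
  have hLp : LpNormAnn p u ≤ ((A ^ (1 / p) * C₀ ^ (1 / 2 : ℝ) : NNReal) : ℝ≥0∞) * KNorm γ 1 u := by
    have h := hA (hu.continuous_logPullback δ) (hu.continuous_logPullbackDeriv₁ δ)
      (hu.continuous_logPullbackDeriv₂ δ) (hu.hasDerivAt_logPullback₁ δ) (hu.hasDerivAt_logPullback₂ δ)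
    have hH := hu.lintegral_logPullback_le γ
    have hL := hu.lintegral_enorm_rpow_le_logPullback hp0.le hpδ
    unfold LpNormAnn KNorm
    calc _ ≤ (A * (C₀ * KNormSq γ 1 u) ^ (p / 2)) ^ (1 / p) := by
          gcongr
          exact hL.trans (h.trans (by gcongr))
      _ = _ := by
          rw [ENNReal.mul_rpow_of_nonneg _ _ (by positivity), ← ENNReal.rpow_mul,
            show p / 2 * (1 / p) = 1 / 2 by field_simp,
            ENNReal.mul_rpow_of_nonneg _ _ (by norm_num), ENNReal.coe_mul,
            ENNReal.coe_rpow_of_nonneg _ (by positivity),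
            ENNReal.coe_rpow_of_nonneg _ (by norm_num), mul_assoc]
  refine hLp.trans ?_
  gcongr
  rw [← ENNReal.ofReal_coe_nnreal]
  exact ENNReal.ofReal_le_ofReal (by linarith)
end
end

section
/- Let γ be a real number. There exists a constant C > 0 such that for every smooth function u : (0,1] × 𝕋 → ℂ with ‖u‖_{K_γ^1} < ∞, the function I(θ) = ( ∫₀¹ ψ^{−2γ} |u(ψ,θ)|² dψ )^{1/2} is continuous on 𝕋 and satisfies |I(θ)| ≤ C ‖u‖_{K_γ^1} for all θ ∈ 𝕋. -/
open MeasureTheory Real Set ENNReal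

noncomputable section

/-- The function `I(θ) = (∫₀¹ ψ^(-2γ) |u(ψ,θ)|² dψ)^(1/2)`. -/
def Ifun (γ : ℝ) (u : ℝ → ℝ → ℂ) : ℝ → ℝ :=
  fun θ => ((∫⁻ ψ in Ioc (0:ℝ) 1,
    ENNReal.ofReal (ψ ^ (-(2*γ)) * ‖u ψ θ‖^2)) ^ ((1:ℝ)/2)).toReal

/-- A one-dimensional Sobolev inequality: a `2π`-periodic `C¹` function is bounded pointwise by its
`H¹` norm over one period. -/
theorem norm_sq_le_two_mul_integral_of_periodic {φ : ℝ → ℂ} (hφ : ContDiff ℝ 1 φ)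
    (hper : Function.Periodic φ (2 * π)) (θ : ℝ) :
    ‖φ θ‖ ^ 2 ≤ 2 * ∫ t in (0:ℝ)..(2 * π), (‖φ t‖ ^ 2 + ‖deriv φ t‖ ^ 2) := by
  have hπ : (0:ℝ) < 2 * π := by positivity
  obtain ⟨x, hx, hxθ⟩ := hper.exists_mem_Ico₀ hπ θ
  rw [hxθ]
  have hc : Continuous φ := hφ.continuous
  have hc' : Continuous (deriv φ) := hφ.continuous_deriv le_rfl
  set g : ℝ → ℝ := fun t => ‖φ t‖ ^ 2 + ‖deriv φ t‖ ^ 2 with hg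
  have hgc : Continuous g := by fun_prop
  have hg0 : ∀ t, 0 ≤ g t := fun t => by positivity
  have hder : ∀ t, HasDerivAt (fun s => ‖φ s‖ ^ 2) (2 * inner ℝ (φ t) (deriv φ t)) t := fun t =>
    ((hφ.differentiable one_ne_zero t).hasDerivAt).norm_sq
  have hbd : ∀ t, |2 * inner ℝ (φ t) (deriv φ t)| ≤ g t := fun t => by
    rw [abs_mul, abs_two]
    nlinarith [abs_real_inner_le_norm (φ t) (deriv φ t), sq_nonneg (‖φ t‖ - ‖deriv φ t‖)]
  have hic : Continuous fun t => 2 * inner ℝ (φ t) (deriv φ t) := by fun_prop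
  have hosc : ∀ t ∈ Icc (0:ℝ) (2 * π), ‖φ x‖ ^ 2 ≤ ‖φ t‖ ^ 2 + ∫ s in (0:ℝ)..(2 * π), g s := by
    intro t ht
    have hftc : ∫ s in t..x, 2 * inner ℝ (φ s) (deriv φ s) = ‖φ x‖ ^ 2 - ‖φ t‖ ^ 2 :=
      intervalIntegral.integral_eq_sub_of_hasDerivAt (fun s _ => hder s)
        (hic.intervalIntegrable _ _)
    have hle : ‖∫ s in t..x, 2 * inner ℝ (φ s) (deriv φ s)‖ ≤ ∫ s in (0:ℝ)..(2 * π), g s := by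
      refine intervalIntegral.norm_integral_le_integral_norm_uIoc.trans ?_
      rw [intervalIntegral.integral_of_le hπ.le]
      have hgi : IntegrableOn g (Ioc 0 (2 * π)) := hgc.integrableOn_Ioc
      have hsub : uIoc t x ⊆ Ioc 0 (2 * π) :=
        Ioc_subset_Ioc (le_min ht.1 hx.1) (max_le ht.2 hx.2.le)
      calc ∫ s in uIoc t x, ‖2 * inner ℝ (φ s) (deriv φ s)‖
          ≤ ∫ s in uIoc t x, g s :=
            integral_mono (hic.norm.integrableOn_uIoc) (hgi.mono_set hsub) hbd
        _ ≤ ∫ s in Ioc 0 (2 * π), g s :=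
            setIntegral_mono_set hgi (ae_of_all _ hg0) hsub.eventuallyLE
    rw [hftc] at hle
    linarith [le_abs_self (‖φ x‖ ^ 2 - ‖φ t‖ ^ 2), Real.norm_eq_abs (‖φ x‖ ^ 2 - ‖φ t‖ ^ 2)]
  set J := ∫ s in (0:ℝ)..(2 * π), g s with hJ
  have hJ0 : 0 ≤ J := intervalIntegral.integral_nonneg hπ.le fun t _ => hg0 t
  have hint : ∫ _t in (0:ℝ)..(2 * π), ‖φ x‖ ^ 2 ≤ ∫ t in (0:ℝ)..(2 * π), (g t + J) := by
    refine intervalIntegral.integral_mono_on hπ.le (by simp)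
      ((hgc.add continuous_const).intervalIntegrable _ _) fun t ht => ?_
    have := hosc t ht
    have : ‖φ t‖ ^ 2 ≤ g t := by simp only [hg]; nlinarith [sq_nonneg ‖deriv φ t‖]
    linarith
  rw [intervalIntegral.integral_add (hgc.intervalIntegrable _ _) (by simp), ← hJ] at hint
  simp only [intervalIntegral.integral_const, sub_zero, smul_eq_mul] at hint
  nlinarith [Real.pi_gt_three]

theorem lintegral_ofReal_weight_le {w : ℝ} (hw : 0 ≤ w) {φ : ℝ → ℂ} (hφ : ContDiff ℝ 1 φ)
    (hper : Function.Periodic φ (2 * π)) (θ : ℝ) :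
    ENNReal.ofReal (w * ‖φ θ‖ ^ 2) ≤
      2 * ((∫⁻ t in Ioc (0:ℝ) (2 * π), ENNReal.ofReal (w * ‖φ t‖ ^ 2)) +
        ∫⁻ t in Ioc (0:ℝ) (2 * π), ENNReal.ofReal (w * ‖deriv φ t‖ ^ 2)) := by
  have hc : Continuous φ := hφ.continuous
  have hc' : Continuous (deriv φ) := hφ.continuous_deriv le_rfl
  rw [← lintegral_add_left (by fun_prop)]
  have hadd : ∀ t, ENNReal.ofReal (w * ‖φ t‖ ^ 2) + ENNReal.ofReal (w * ‖deriv φ t‖ ^ 2) =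
      ENNReal.ofReal (w * (‖φ t‖ ^ 2 + ‖deriv φ t‖ ^ 2)) := fun t => by
    rw [← ENNReal.ofReal_add (by positivity) (by positivity), mul_add]
  have hcont : Continuous fun t => w * (‖φ t‖ ^ 2 + ‖deriv φ t‖ ^ 2) := by fun_prop
  simp only [hadd]
  rw [← ofReal_integral_eq_lintegral_ofReal hcont.integrableOn_Ioc
      (ae_of_all _ fun t => by positivity), integral_const_mul,
    ← intervalIntegral.integral_of_le (by positivity), ← ENNReal.ofReal_ofNat 2,
    ← ENNReal.ofReal_mul zero_le_two]
  refine ENNReal.ofReal_le_ofReal ?_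
  calc w * ‖φ θ‖ ^ 2 ≤ w * (2 * ∫ t in (0:ℝ)..(2 * π), (‖φ t‖ ^ 2 + ‖deriv φ t‖ ^ 2)) :=
        mul_le_mul_of_nonneg_left (norm_sq_le_two_mul_integral_of_periodic hφ hper θ) hw
    _ = _ := by ring

namespace SmoothAnn

variable {u : ℝ → ℝ → ℂ}

theorem contDiff_slice (hu : SmoothAnn u) {ψ : ℝ} (hψ : 0 < ψ) : ContDiff ℝ 1 (u ψ) := by
  have h : ContDiff ℝ 1 fun θ : ℝ => (ψ, θ) := by fun_prop
  have h2 := (hu.1.of_le (m := 1) (by exact_mod_cast le_top)).comp h.contDiffOn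
    (s := univ) fun θ _ => ⟨hψ, mem_univ θ⟩
  exact contDiffOn_univ.1 h2

theorem aemeasurable_lintegral_slice (hu : SmoothAnn u) (γ : ℝ) :
    AEMeasurable (fun ψ => ∫⁻ t in Ioc (0:ℝ) (2 * π),
      ENNReal.ofReal (ψ ^ (-(2 * γ)) * ‖u ψ t‖ ^ 2)) (volume.restrict (Ioc (0:ℝ) 1)) := by
  have hcont : ContinuousOn (fun z : ℝ × ℝ =>
      ENNReal.ofReal (z.1 ^ (-(2 * γ)) * ‖Function.uncurry u z‖ ^ 2))
      (Ioc (0:ℝ) 1 ×ˢ Ioc (0:ℝ) (2 * π)) := by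
    refine ENNReal.continuous_ofReal.comp_continuousOn (ContinuousOn.mul ?_ ?_)
    · exact continuousOn_fst.rpow_const fun z hz => Or.inl hz.1.1.ne'
    · exact ((hu.1.continuousOn.mono (prod_mono (fun x hx => hx.1) (subset_univ _))).norm).pow 2
  have hm := hcont.aemeasurable (μ := (volume : Measure ℝ).prod volume)
    (measurableSet_Ioc.prod measurableSet_Ioc)
  rw [← Measure.prod_restrict] at hm
  exact hm.lintegral_prod_right'

theorem aemeasurable_section (hu : SmoothAnn u) (γ θ : ℝ) :
    AEMeasurable (fun ψ => ENNReal.ofReal (ψ ^ (-(2 * γ)) * ‖u ψ θ‖ ^ 2))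
      (volume.restrict (Ioc (0:ℝ) 1)) := by
  refine ContinuousOn.aemeasurable ?_ measurableSet_Ioc
  refine ENNReal.continuous_ofReal.comp_continuousOn (ContinuousOn.mul ?_ ?_)
  · exact continuousOn_id.rpow_const fun z hz => Or.inl (ne_of_gt hz.1)
  · have h : ContinuousOn (fun ψ => Function.uncurry u (ψ, θ)) (Ioc (0:ℝ) 1) :=
      hu.1.continuousOn.comp (by fun_prop) fun ψ hψ => ⟨hψ.1, mem_univ θ⟩
    exact h.norm.pow 2

end SmoothAnn

/-- The `H¹(𝕋)` norm in the angular variable, weighted at `ψ`. -/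
def angularNormSq (γ : ℝ) (u : ℝ → ℝ → ℂ) (ψ : ℝ) : ℝ≥0∞ :=
  (∫⁻ t in Ioc (0:ℝ) (2 * π), ENNReal.ofReal (ψ ^ (-(2 * γ)) * ‖u ψ t‖ ^ 2)) +
    ∫⁻ t in Ioc (0:ℝ) (2 * π), ENNReal.ofReal (ψ ^ (-(2 * γ)) * ‖deriv (u ψ) t‖ ^ 2)

theorem lintegral_angularNormSq_le {γ : ℝ} {u : ℝ → ℝ → ℂ} (hu : SmoothAnn u) :
    ∫⁻ ψ in Ioc (0:ℝ) 1, angularNormSq γ u ψ ≤ KNormSq γ 1 u := by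
  unfold angularNormSq
  rw [lintegral_add_left' (hu.aemeasurable_lintegral_slice γ)]
  have hexp : (2:ℝ) * (((0:ℕ):ℝ) - γ) = -(2 * γ) := by push_cast; ring
  simp only [KNormSq, Finset.sum_range_succ, Finset.sum_range_zero, zero_add, pder, hexp,
    iteratedDeriv_zero, iteratedDeriv_one, tsub_zero]
  exact le_self_add

/-- For `u ∈ K_γ^1(Π)`, the function `I(θ) = (∫₀¹ ψ^(-2γ)|u(ψ,θ)|² dψ)^(1/2)`
is continuous on `𝕋` and satisfies `|I(θ)| ≤ C ‖u‖_{K_γ^1}`. -/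
theorem Ifun_continuous_bounded (γ : ℝ) :
    ∃ C > 0, ∀ u : ℝ → ℝ → ℂ, SmoothAnn u → KNorm γ 1 u ≠ ⊤ →
      Continuous (Ifun γ u) ∧
        ∀ θ : ℝ, |Ifun γ u θ| ≤ C * (KNorm γ 1 u).toReal := by
  refine ⟨2, two_pos, fun u hu hfin => ?_⟩
  have hK : KNormSq γ 1 u ≠ ⊤ := fun h => hfin (by simp [KNorm, h])
  have hbound : ∀ θ, ∀ᵐ ψ ∂(volume.restrict (Ioc (0:ℝ) 1)),
      ENNReal.ofReal (ψ ^ (-(2 * γ)) * ‖u ψ θ‖ ^ 2) ≤ 2 * angularNormSq γ u ψ := fun θ =>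
    (ae_restrict_mem measurableSet_Ioc).mono fun ψ hψ =>
      lintegral_ofReal_weight_le (rpow_nonneg hψ.1.le _) (hu.contDiff_slice hψ.1) (hu.2 ψ) θ
  have hmajor : ∫⁻ ψ in Ioc (0:ℝ) 1, 2 * angularNormSq γ u ψ ≤ 2 * KNormSq γ 1 u := by
    rw [lintegral_const_mul' _ _ ENNReal.ofNat_ne_top]
    exact mul_le_mul_right (lintegral_angularNormSq_le hu) 2
  have hmajor_fin : 2 * KNormSq γ 1 u ≠ ⊤ := ENNReal.mul_ne_top ENNReal.ofNat_ne_top hK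
  have hle : ∀ θ, ∫⁻ ψ in Ioc (0:ℝ) 1, ENNReal.ofReal (ψ ^ (-(2 * γ)) * ‖u ψ θ‖ ^ 2) ≤
      2 * KNormSq γ 1 u := fun θ => (lintegral_mono_ae (hbound θ)).trans hmajor
  have hcont : Continuous fun θ =>
      ∫⁻ ψ in Ioc (0:ℝ) 1, ENNReal.ofReal (ψ ^ (-(2 * γ)) * ‖u ψ θ‖ ^ 2) := by
    refine continuous_iff_continuousAt.2 fun θ => ?_
    refine tendsto_lintegral_filter_of_dominated_convergence' _
      (Filter.Eventually.of_forall fun t => hu.aemeasurable_section γ t)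
      (Filter.Eventually.of_forall hbound) (ne_top_of_le_ne_top hmajor_fin hmajor) ?_
    filter_upwards [ae_restrict_mem measurableSet_Ioc] with ψ hψ
    have hc : Continuous (u ψ) := (hu.contDiff_slice hψ.1).continuous
    exact (ENNReal.continuous_ofReal.comp (continuous_const.mul (hc.norm.pow 2))).continuousAt
  constructor
  · refine ENNReal.continuousOn_toReal.comp_continuous
      (ENNReal.continuous_rpow_const.comp hcont) fun θ => ?_
    exact ENNReal.rpow_ne_top_of_nonneg (by norm_num) (ne_top_of_le_ne_top hmajor_fin (hle θ))
  · intro θ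
    have h4 : (2:ℝ≥0∞) ≤ 2 ^ (2:ℝ) := by
      norm_num
    have hroot : ((2:ℝ≥0∞) ^ (2:ℝ)) ^ ((1:ℝ) / 2) = 2 := by
      rw [← ENNReal.rpow_mul]; norm_num
    have key := ENNReal.rpow_le_rpow ((hle θ).trans (mul_le_mul_left h4 (KNormSq γ 1 u)))
      (by norm_num : (0:ℝ) ≤ 1 / 2)
    rw [ENNReal.mul_rpow_of_nonneg _ _ (by norm_num), hroot] at key
    rw [Ifun, abs_of_nonneg ENNReal.toReal_nonneg]
    refine (ENNReal.toReal_mono (ENNReal.mul_ne_top ENNReal.ofNat_ne_top hfin) key).trans_eq ?_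
    rw [ENNReal.toReal_mul]
    rfl
end
end

section
/- Let m ≥ 2 be an integer and γ > 1/2 a real number. Then there exists a constant C > 0 such that for all smooth functions u, v : (0,1] × 𝕋 → ℂ with ‖u‖_{K_γ^m} < ∞ and ‖v‖_{K_γ^m} < ∞, the pointwise product u·v satisfies ‖u v‖_{K_γ^m} ≤ C ‖u‖_{K_γ^m} ‖v‖_{K_γ^m}. -/
open MeasureTheory Real Set ENNReal

noncomputable section

theorem sq_integral_le_length_mul_integral_sq {a b : ℝ} (hab : a ≤ b) {g : ℝ → ℝ}
    (hg : ContinuousOn g (Icc a b)) :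
    (∫ s in a..b, g s) ^ 2 ≤ (b - a) * ∫ s in a..b, g s ^ 2 := by
  rcases hab.eq_or_lt with rfl | hlt
  · simp
  set J := ∫ s in a..b, g s with hJ
  have hgu : ContinuousOn g (uIcc a b) := by rwa [uIcc_of_le hab]
  have i1 : IntervalIntegrable g volume a b := hgu.intervalIntegrable
  have i2 : IntervalIntegrable (fun s => g s ^ 2) volume a b := (hgu.pow 2).intervalIntegrable
  have h0 : 0 ≤ ∫ s in a..b, ((b - a) * g s - J) ^ 2 :=
    intervalIntegral.integral_nonneg hab fun s _ => sq_nonneg _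
  have h1 : ∫ s in a..b, ((b - a) * g s - J) ^ 2
      = (b - a) ^ 2 * (∫ s in a..b, g s ^ 2) - 2 * (b - a) * J * J + (b - a) * J ^ 2 := by
    have : ∀ s, ((b - a) * g s - J) ^ 2
        = (b - a) ^ 2 * g s ^ 2 - 2 * (b - a) * J * g s + J ^ 2 := fun s => by ring
    simp_rw [this]
    rw [intervalIntegral.integral_add ((i2.const_mul _).sub (i1.const_mul _))
      intervalIntegrable_const, intervalIntegral.integral_sub (i2.const_mul _) (i1.const_mul _),
      intervalIntegral.integral_const_mul, intervalIntegral.integral_const_mul,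
      intervalIntegral.integral_const, smul_eq_mul]
  rw [h1] at h0
  have h2 : 0 ≤ (b - a) * ((b - a) * (∫ s in a..b, g s ^ 2) - J ^ 2) := by linarith
  have := nonneg_of_mul_nonneg_right h2 (sub_pos.2 hlt)
  linarith

/-- One-dimensional Sobolev inequality on an interval. -/
theorem length_mul_norm_sq_le {a b : ℝ} {h h' : ℝ → ℂ}
    (hd : ∀ s ∈ Icc a b, HasDerivAt h (h' s) s) (hc : ContinuousOn h' (Icc a b))
    {x : ℝ} (hx : x ∈ Icc a b) :
    (b - a) * ‖h x‖ ^ 2 ≤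
      2 * (∫ s in a..b, ‖h s‖ ^ 2) + 2 * (b - a) ^ 2 * ∫ s in a..b, ‖h' s‖ ^ 2 := by
  have hab : a ≤ b := hx.1.trans hx.2
  have hch : ContinuousOn h (Icc a b) := fun s hs => (hd s hs).continuousAt.continuousWithinAt
  set J := ∫ s in a..b, ‖h' s‖ with hJ
  have hi' : IntervalIntegrable (fun s => ‖h' s‖) volume a b := by
    apply ContinuousOn.intervalIntegrable
    rw [uIcc_of_le hab]; exact hc.norm
  have hi : IntervalIntegrable (fun s => ‖h s‖ ^ 2) volume a b := by
    apply ContinuousOn.intervalIntegrable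
    rw [uIcc_of_le hab]; exact hch.norm.pow 2
  have hJ2 : J ^ 2 ≤ (b - a) * ∫ s in a..b, ‖h' s‖ ^ 2 :=
    sq_integral_le_length_mul_integral_sq hab hc.norm
  have key : ∀ s ∈ Icc a b, ‖h x‖ ^ 2 ≤ 2 * ‖h s‖ ^ 2 + 2 * J ^ 2 := by
    intro s hs
    have hsub : uIcc s x ⊆ Icc a b := uIcc_subset_Icc hs hx
    have e : ∫ t in s..x, h' t = h x - h s :=
      intervalIntegral.integral_eq_sub_of_hasDerivAt (fun t ht => hd t (hsub ht))
        (hc.mono hsub).intervalIntegrable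
    have h1 : ‖h x - h s‖ ≤ J := by
      rw [← e]
      refine intervalIntegral.norm_integral_le_integral_norm_uIoc.trans ?_
      rw [hJ, intervalIntegral.integral_of_le hab]
      refine setIntegral_mono_set hi'.1 (Filter.Eventually.of_forall fun _ => norm_nonneg _) ?_
      apply Filter.Eventually.of_forall
      intro t ht
      rcases mem_uIoc.1 ht with ht | ht
      · exact ⟨hs.1.trans_lt ht.1, ht.2.trans hx.2⟩
      · exact ⟨hx.1.trans_lt ht.1, ht.2.trans hs.2⟩
    have h2 : ‖h x‖ ≤ ‖h s‖ + J := by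
      have := norm_add_le (h s) (h x - h s)
      rw [add_sub_cancel] at this; linarith
    have h3 := pow_le_pow_left₀ (norm_nonneg _) h2 2
    nlinarith [sq_nonneg (‖h s‖ - J)]
  have hint := intervalIntegral.integral_mono_on hab intervalIntegrable_const
    ((hi.const_mul 2).add intervalIntegrable_const) key
  rw [intervalIntegral.integral_const, intervalIntegral.integral_add (hi.const_mul 2)
    intervalIntegrable_const, intervalIntegral.integral_const_mul,
    intervalIntegral.integral_const, smul_eq_mul, smul_eq_mul] at hint
  have := mul_le_mul_of_nonneg_left hJ2 (sub_nonneg.2 hab)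
  nlinarith

theorem ofReal_intervalIntegral_norm_sq {a b : ℝ} (hab : a ≤ b) {h : ℝ → ℂ}
    (hc : ContinuousOn h (Icc a b)) :
    ENNReal.ofReal (∫ s in a..b, ‖h s‖ ^ 2) = ∫⁻ s in Ioc a b, ENNReal.ofReal (‖h s‖ ^ 2) := by
  rw [intervalIntegral.integral_of_le hab]
  apply ofReal_integral_eq_lintegral_ofReal
  · exact ((hc.norm.pow 2).integrableOn_Icc).mono_set Ioc_subset_Icc_self
  · exact Filter.Eventually.of_forall fun _ => sq_nonneg _

theorem ofReal_length_mul_norm_sq_le {a b : ℝ} {h h' : ℝ → ℂ}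
    (hd : ∀ s ∈ Icc a b, HasDerivAt h (h' s) s) (hc : ContinuousOn h' (Icc a b))
    {x : ℝ} (hx : x ∈ Icc a b) :
    ENNReal.ofReal ((b - a) * ‖h x‖ ^ 2) ≤
      ENNReal.ofReal 2 * (∫⁻ s in Ioc a b, ENNReal.ofReal (‖h s‖ ^ 2)) +
        ENNReal.ofReal (2 * (b - a) ^ 2) * ∫⁻ s in Ioc a b, ENNReal.ofReal (‖h' s‖ ^ 2) := by
  have hab : a ≤ b := hx.1.trans hx.2
  have hch : ContinuousOn h (Icc a b) := fun s hs => (hd s hs).continuousAt.continuousWithinAt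
  rw [← ofReal_intervalIntegral_norm_sq hab hch, ← ofReal_intervalIntegral_norm_sq hab hc,
    ← ENNReal.ofReal_mul (by norm_num), ← ENNReal.ofReal_mul (by positivity)]
  exact (ENNReal.ofReal_le_ofReal (length_mul_norm_sq_le hd hc hx)).trans ENNReal.ofReal_add_le

theorem rpow_le_two_rpow_abs_mul_rpow (c : ℝ) {x s : ℝ} (hx : 0 < x) (h1 : x / 2 ≤ s)
    (h2 : s ≤ x) : x ^ c ≤ 2 ^ |c| * s ^ c := by
  have hs : 0 < s := by linarith
  rcases le_total 0 c with hc | hc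
  · rw [abs_of_nonneg hc, ← Real.mul_rpow (by norm_num) hs.le]
    exact Real.rpow_le_rpow hx.le (by linarith) hc
  · calc x ^ c ≤ 1 * s ^ c := by
          rw [one_mul]; exact Real.rpow_le_rpow_of_nonpos hs h2 hc
      _ ≤ _ := by
          gcongr
          exact Real.one_le_rpow (by norm_num) (abs_nonneg c)

theorem ofReal_rpow_mul_lintegral_le (c : ℝ) {x : ℝ} (hx : 0 < x) (hx1 : x ≤ 1) (h : ℝ → ℂ) :
    ENNReal.ofReal (x ^ c) * (∫⁻ s in Ioc (x / 2) x, ENNReal.ofReal (‖h s‖ ^ 2)) ≤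
      ENNReal.ofReal (2 ^ |c|) *
        ∫⁻ s in Ioc (0:ℝ) 1, ENNReal.ofReal (s ^ c * ‖h s‖ ^ 2) := by
  rw [← lintegral_const_mul' _ _ ENNReal.ofReal_ne_top,
    ← lintegral_const_mul' _ _ ENNReal.ofReal_ne_top]
  refine (setLIntegral_mono' measurableSet_Ioc fun s hs => ?_).trans
    (lintegral_mono_set (Ioc_subset_Ioc (by linarith) hx1))
  rw [← ENNReal.ofReal_mul (by positivity), ← ENNReal.ofReal_mul (by positivity), ← mul_assoc]
  apply ENNReal.ofReal_le_ofReal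
  gcongr
  exact rpow_le_two_rpow_abs_mul_rpow c hx hs.1.le hs.2

/-- Scale-invariant one-dimensional Sobolev inequality on `(0,1]` with power weights. -/
theorem weighted_sup_le (a : ℝ) {h h' : ℝ → ℂ}
    (hd : ∀ s, 0 < s → HasDerivAt h (h' s) s) (hc : ContinuousOn h' (Ioi 0))
    {x : ℝ} (hx : 0 < x) (hx1 : x ≤ 1) :
    ENNReal.ofReal (x ^ (a + 1) * ‖h x‖ ^ 2) ≤
      ENNReal.ofReal (4 * 2 ^ |a| + 2 ^ |a + 2|) *
        ((∫⁻ s in Ioc (0:ℝ) 1, ENNReal.ofReal (s ^ a * ‖h s‖ ^ 2)) +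
          ∫⁻ s in Ioc (0:ℝ) 1, ENNReal.ofReal (s ^ (a + 2) * ‖h' s‖ ^ 2)) := by
  have hsub : Icc (x / 2) x ⊆ Ioi 0 := fun s hs => lt_of_lt_of_le (by linarith) hs.1
  have key := ofReal_length_mul_norm_sq_le (a := x / 2) (b := x)
    (fun s hs => hd s (hsub hs)) (hc.mono hsub) (x := x) ⟨by linarith, le_rfl⟩
  have key2 := mul_le_mul_right key (ENNReal.ofReal (2 * x ^ a))
  have e1 : ENNReal.ofReal (x ^ (a + 1) * ‖h x‖ ^ 2)
      = ENNReal.ofReal (2 * x ^ a) * ENNReal.ofReal ((x - x / 2) * ‖h x‖ ^ 2) := by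
    rw [← ENNReal.ofReal_mul (by positivity), Real.rpow_add_one hx.ne']
    congr 1; ring
  rw [e1]
  refine key2.trans ?_
  have e2 : ENNReal.ofReal (2 * x ^ a) * ENNReal.ofReal 2
      = ENNReal.ofReal 4 * ENNReal.ofReal (x ^ a) := by
    rw [← ENNReal.ofReal_mul (by positivity), ← ENNReal.ofReal_mul (by positivity)]
    congr 1; ring
  have e3 : ENNReal.ofReal (2 * x ^ a) * ENNReal.ofReal (2 * (x - x / 2) ^ 2)
      = ENNReal.ofReal (x ^ (a + 2)) := by
    rw [← ENNReal.ofReal_mul (by positivity), Real.rpow_add hx, Real.rpow_two]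
    congr 1; ring
  rw [mul_add, ← mul_assoc, ← mul_assoc, e2, e3, mul_assoc]
  rw [mul_add]
  gcongr ?_ + ?_
  · refine (mul_le_mul_right (ofReal_rpow_mul_lintegral_le a hx hx1 h) _).trans ?_
    rw [← mul_assoc, ← ENNReal.ofReal_mul (by positivity)]
    gcongr
    have : (0:ℝ) ≤ 2 ^ |a + 2| := by positivity
    linarith
  · refine (ofReal_rpow_mul_lintegral_le (a + 2) hx hx1 h').trans ?_
    gcongr
    have : (0:ℝ) ≤ 4 * 2 ^ |a| := by positivity
    linarith

/-- Joint smoothness on the open half-plane `ψ > 0`. -/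
def SmoothHalfPlane (f : ℝ → ℝ → ℂ) : Prop :=
  ContDiffOn ℝ (⊤ : ℕ∞) (Function.uncurry f) (Ioi (0:ℝ) ×ˢ (univ : Set ℝ))

theorem isOpen_halfPlane : IsOpen (Ioi (0:ℝ) ×ˢ (univ : Set ℝ)) := isOpen_Ioi.prod isOpen_univ

namespace SmoothHalfPlane

variable {f : ℝ → ℝ → ℂ}

theorem contDiffAt (hf : SmoothHalfPlane f) {ψ : ℝ} (hψ : 0 < ψ) (θ : ℝ) :
    ContDiffAt ℝ (⊤ : ℕ∞) (Function.uncurry f) (ψ, θ) :=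
  ContDiffOn.contDiffAt hf (isOpen_halfPlane.mem_nhds ⟨hψ, mem_univ _⟩)

theorem contDiffAt_left (hf : SmoothHalfPlane f) {ψ : ℝ} (hψ : 0 < ψ) (θ : ℝ) :
    ContDiffAt ℝ (⊤ : ℕ∞) (fun s => f s θ) ψ :=
  ContDiffAt.comp (f := fun s : ℝ => (s, θ)) ψ (hf.contDiffAt hψ θ)
    (contDiffAt_id.prodMk contDiffAt_const)

theorem contDiffAt_right (hf : SmoothHalfPlane f) {ψ : ℝ} (hψ : 0 < ψ) (θ : ℝ) :
    ContDiffAt ℝ (⊤ : ℕ∞) (f ψ) θ :=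
  ContDiffAt.comp (f := fun t : ℝ => (ψ, t)) θ (hf.contDiffAt hψ θ)
    (contDiffAt_const.prodMk contDiffAt_id)

theorem hasFDerivAt (hf : SmoothHalfPlane f) {ψ : ℝ} (hψ : 0 < ψ) (θ : ℝ) :
    HasFDerivAt (Function.uncurry f) (fderiv ℝ (Function.uncurry f) (ψ, θ)) (ψ, θ) :=
  ((hf.contDiffAt hψ θ).differentiableAt (by simp)).hasFDerivAt

theorem deriv_left_eq (hf : SmoothHalfPlane f) {ψ : ℝ} (hψ : 0 < ψ) (θ : ℝ) :
    deriv (fun s => f s θ) ψ = fderiv ℝ (Function.uncurry f) (ψ, θ) (1, 0) :=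
  ((hf.hasFDerivAt hψ θ).comp_hasDerivAt (f := fun s : ℝ => (s, θ)) ψ
    ((hasDerivAt_id ψ).prodMk (hasDerivAt_const ψ θ))).deriv

theorem deriv_right_eq (hf : SmoothHalfPlane f) {ψ : ℝ} (hψ : 0 < ψ) (θ : ℝ) :
    deriv (f ψ) θ = fderiv ℝ (Function.uncurry f) (ψ, θ) (0, 1) :=
  ((hf.hasFDerivAt hψ θ).comp_hasDerivAt (f := fun t : ℝ => (ψ, t)) θ
    ((hasDerivAt_const θ ψ).prodMk (hasDerivAt_id θ))).deriv

theorem contDiffOn_fderiv (hf : SmoothHalfPlane f) :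
    ContDiffOn ℝ (⊤ : ℕ∞) (fderiv ℝ (Function.uncurry f)) (Ioi (0:ℝ) ×ˢ (univ : Set ℝ)) :=
  ContDiffOn.fderiv_of_isOpen hf isOpen_halfPlane (by simp)

theorem deriv_left (hf : SmoothHalfPlane f) :
    SmoothHalfPlane (fun ψ θ => deriv (fun s => f s θ) ψ) :=
  (hf.contDiffOn_fderiv.clm_apply (contDiffOn_const (c := ((1:ℝ), (0:ℝ))))).congr
    fun x hx => hf.deriv_left_eq hx.1 x.2

theorem deriv_right (hf : SmoothHalfPlane f) :
    SmoothHalfPlane (fun ψ θ => deriv (f ψ) θ) :=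
  (hf.contDiffOn_fderiv.clm_apply (contDiffOn_const (c := ((0:ℝ), (1:ℝ))))).congr
    fun x hx => hf.deriv_right_eq hx.1 x.2

/-- Symmetry of the mixed second derivative. -/
theorem deriv_comm (hf : SmoothHalfPlane f) {ψ : ℝ} (hψ : 0 < ψ) (θ : ℝ) :
    deriv (fun t => deriv (fun s => f s t) ψ) θ = deriv (fun s => deriv (f s) θ) ψ := by
  have h2 : HasFDerivAt (fderiv ℝ (Function.uncurry f))
      (fderiv ℝ (fderiv ℝ (Function.uncurry f)) (ψ, θ)) (ψ, θ) :=
    ((hf.contDiffOn_fderiv.contDiffAt (isOpen_halfPlane.mem_nhds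
      (show (ψ, θ) ∈ Ioi (0:ℝ) ×ˢ (univ : Set ℝ) from ⟨hψ, mem_univ _⟩))).differentiableAt
      (by simp)).hasFDerivAt
  have e1 : (fun t => deriv (fun s => f s t) ψ)
      = fun t => fderiv ℝ (Function.uncurry f) (ψ, t) (1, 0) :=
    funext fun t => hf.deriv_left_eq hψ t
  have e2 : (fun s => deriv (f s) θ)
      =ᶠ[nhds ψ] fun s => fderiv ℝ (Function.uncurry f) (s, θ) (0, 1) := by
    filter_upwards [Ioi_mem_nhds hψ] with s hs using hf.deriv_right_eq hs θ
  have d1 : HasDerivAt (fun t => fderiv ℝ (Function.uncurry f) (ψ, t))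
      (fderiv ℝ (fderiv ℝ (Function.uncurry f)) (ψ, θ) (0, 1)) θ :=
    h2.comp_hasDerivAt (f := fun t : ℝ => (ψ, t)) θ
      ((hasDerivAt_const θ ψ).prodMk (hasDerivAt_id θ))
  have d2 : HasDerivAt (fun s => fderiv ℝ (Function.uncurry f) (s, θ))
      (fderiv ℝ (fderiv ℝ (Function.uncurry f)) (ψ, θ) (1, 0)) ψ :=
    h2.comp_hasDerivAt (f := fun s : ℝ => (s, θ)) ψ
      ((hasDerivAt_id ψ).prodMk (hasDerivAt_const ψ θ))
  rw [e1, e2.deriv_eq, (d1.clm_apply (hasDerivAt_const θ ((1:ℝ), (0:ℝ)))).deriv,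
    (d2.clm_apply (hasDerivAt_const ψ ((0:ℝ), (1:ℝ)))).deriv]
  simp only [map_zero, add_zero]
  exact ((hf.contDiffAt hψ θ).isSymmSndFDerivAt (by
    rw [minSmoothness_of_isRCLikeNormedField]
    exact WithTop.coe_le_coe.2 (le_top : (2 : ℕ∞) ≤ ⊤))).eq _ _

theorem pder_zero_succ (q : ℕ) (f : ℝ → ℝ → ℂ) :
    pder 0 (q + 1) f = fun ψ θ => deriv (pder 0 q f ψ) θ := by
  funext ψ θ
  have h : pder 0 q f ψ = iteratedDeriv q (f ψ) :=
    funext fun t => by simp only [pder, iteratedDeriv_zero]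
  rw [h]
  simp only [pder, iteratedDeriv_zero, iteratedDeriv_succ]

theorem pder_succ (p q : ℕ) (f : ℝ → ℝ → ℂ) :
    pder (p + 1) q f = fun ψ θ => deriv (fun s => pder p q f s θ) ψ := by
  funext ψ θ
  simp only [pder, iteratedDeriv_succ]

theorem smooth_pder (hf : SmoothHalfPlane f) (p q : ℕ) : SmoothHalfPlane (pder p q f) := by
  induction p with
  | zero =>
    induction q with
    | zero => exact hf
    | succ q ih => rw [pder_zero_succ]; exact ih.deriv_right
  | succ p ih => rw [pder_succ]; exact ih.deriv_left

theorem deriv_pder_right (hf : SmoothHalfPlane f) (p q : ℕ) {ψ : ℝ} (hψ : 0 < ψ) (θ : ℝ) :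
    deriv (pder p q f ψ) θ = pder p (q + 1) f ψ θ := by
  induction p generalizing ψ θ with
  | zero => rw [pder_zero_succ]
  | succ p ih =>
    rw [pder_succ, pder_succ, (hf.smooth_pder p q).deriv_comm hψ]
    apply Filter.EventuallyEq.deriv_eq
    filter_upwards [Ioi_mem_nhds hψ] with s hs using ih hs θ

theorem hasDerivAt_pder_left (hf : SmoothHalfPlane f) (p q : ℕ) {ψ : ℝ} (hψ : 0 < ψ) (θ : ℝ) :
    HasDerivAt (fun s => pder p q f s θ) (pder (p + 1) q f ψ θ) ψ := by
  rw [pder_succ]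
  exact (((hf.smooth_pder p q).contDiffAt_left hψ θ).differentiableAt (by simp)).hasDerivAt

theorem hasDerivAt_pder_right (hf : SmoothHalfPlane f) (p q : ℕ) {ψ : ℝ} (hψ : 0 < ψ) (θ : ℝ) :
    HasDerivAt (pder p q f ψ) (pder p (q + 1) f ψ θ) θ := by
  rw [← hf.deriv_pder_right p q hψ]
  exact (((hf.smooth_pder p q).contDiffAt_right hψ θ).differentiableAt (by simp)).hasDerivAt

/-- The Leibniz rule for `∂_ψ^p ∂_θ^q`. -/
theorem pder_mul_eq_sum {u v : ℝ → ℝ → ℂ} (hu : SmoothHalfPlane u) (hv : SmoothHalfPlane v)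
    (p q : ℕ) {ψ : ℝ} (hψ : 0 < ψ) (θ : ℝ) :
    pder p q (fun ψ θ => u ψ θ * v ψ θ) ψ θ =
      ∑ j ∈ Finset.range (q + 1), ∑ i ∈ Finset.range (p + 1),
        ((q.choose j : ℂ) * (p.choose i : ℂ)) *
          (pder i j u ψ θ * pder (p - i) (q - j) v ψ θ) := by
  have hle : ∀ n : ℕ, ((n : ℕ∞) : WithTop ℕ∞) ≤ ((⊤ : ℕ∞) : WithTop ℕ∞) := fun n => by
    exact_mod_cast le_top
  have e : (fun s => iteratedDeriv q (fun t => u s t * v s t) θ) =ᶠ[nhds ψ]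
      fun s => ∑ j ∈ Finset.range (q + 1), (q.choose j : ℂ) *
        (pder 0 j u s θ * pder 0 (q - j) v s θ) := by
    filter_upwards [Ioi_mem_nhds hψ] with s hs
    rw [iteratedDeriv_fun_mul ((hu.contDiffAt_right hs θ).of_le (hle q))
      ((hv.contDiffAt_right hs θ).of_le (hle q))]
    simp [pder, mul_assoc]
  have cu : ∀ j, ContDiffAt ℝ p (fun s => pder 0 j u s θ) ψ := fun j =>
    ((hu.smooth_pder 0 j).contDiffAt_left hψ θ).of_le (hle p)
  have cv : ∀ j, ContDiffAt ℝ p (fun s => pder 0 j v s θ) ψ := fun j =>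
    ((hv.smooth_pder 0 j).contDiffAt_left hψ θ).of_le (hle p)
  change iteratedDeriv p (fun s => iteratedDeriv q (fun t => u s t * v s t) θ) ψ = _
  rw [e.iteratedDeriv_eq, iteratedDeriv_fun_sum fun j _ =>
    contDiffAt_const.mul ((cu j).mul (cv (q - j)))]
  refine Finset.sum_congr rfl fun j _ => ?_
  rw [iteratedDeriv_const_mul_field, iteratedDeriv_fun_mul (cu j) (cv (q - j)), Finset.mul_sum]
  refine Finset.sum_congr rfl fun i _ => ?_
  simp only [pder, iteratedDeriv_zero]
  ring

end SmoothHalfPlane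

/-- The integral of `ψ^a ‖f(ψ,θ)‖²` over the annulus. -/
def weightedEnergy (a : ℝ) (f : ℝ → ℝ → ℂ) : ℝ≥0∞ :=
  ∫⁻ ψ in Ioc (0:ℝ) 1, ∫⁻ θ in Ioc (0:ℝ) (2*π), ENNReal.ofReal (ψ ^ a * ‖f ψ θ‖ ^ 2)

/-- The integral of `ψ^a ‖f(ψ,θ)‖²` over the circle at fixed `ψ`. -/
def sliceEnergy (a : ℝ) (f : ℝ → ℝ → ℂ) (ψ : ℝ) : ℝ≥0∞ :=
  ∫⁻ θ in Ioc (0:ℝ) (2*π), ENNReal.ofReal (ψ ^ a * ‖f ψ θ‖ ^ 2)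

theorem lintegral_sliceEnergy (a : ℝ) (f : ℝ → ℝ → ℂ) :
    ∫⁻ ψ in Ioc (0:ℝ) 1, sliceEnergy a f ψ = weightedEnergy a f := rfl

namespace SmoothHalfPlane

variable {f g : ℝ → ℝ → ℂ}

theorem mul (hf : SmoothHalfPlane f) (hg : SmoothHalfPlane g) :
    SmoothHalfPlane (fun ψ θ => f ψ θ * g ψ θ) :=
  ContDiffOn.mul hf hg

theorem aemeasurable_weight_mul_norm_sq (hf : SmoothHalfPlane f) (a : ℝ) :
    AEMeasurable (fun z : ℝ × ℝ => ENNReal.ofReal (z.1 ^ a * ‖f z.1 z.2‖ ^ 2))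
      ((volume.restrict (Ioc (0:ℝ) 1)).prod (volume.restrict (Ioc (0:ℝ) (2*π)))) := by
  rw [Measure.prod_restrict]
  refine (ContinuousOn.aemeasurable ?_ (measurableSet_Ioc.prod measurableSet_Ioc)).ennreal_ofReal
  have h1 : ContinuousOn (Function.uncurry f) (Ioc (0:ℝ) 1 ×ˢ Ioc (0:ℝ) (2*π)) :=
    (ContDiffOn.continuousOn hf).mono fun z hz => ⟨hz.1.1, mem_univ _⟩
  exact (continuousOn_fst.rpow_const fun z hz => Or.inl hz.1.1.ne').mul (h1.norm.pow 2)

theorem aemeasurable_slice (hf : SmoothHalfPlane f) (a : ℝ) {ψ : ℝ} (hψ : 0 < ψ) :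
    AEMeasurable (fun θ => ENNReal.ofReal (ψ ^ a * ‖f ψ θ‖ ^ 2))
      (volume.restrict (Ioc (0:ℝ) (2*π))) := by
  have h1 : Continuous (f ψ) :=
    continuous_iff_continuousAt.2 fun θ => (hf.contDiffAt_right hψ θ).continuousAt
  exact (ENNReal.continuous_ofReal.comp
    (continuous_const.mul (h1.norm.pow 2))).measurable.aemeasurable

theorem aemeasurable_sliceEnergy (hf : SmoothHalfPlane f) (a : ℝ) :
    AEMeasurable (sliceEnergy a f) (volume.restrict (Ioc (0:ℝ) 1)) :=
  (hf.aemeasurable_weight_mul_norm_sq a).lintegral_prod_right'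

theorem weightedEnergy_eq_lintegral_prod (hf : SmoothHalfPlane f) (a : ℝ) :
    weightedEnergy a f = ∫⁻ z, ENNReal.ofReal (z.1 ^ a * ‖f z.1 z.2‖ ^ 2)
      ∂((volume.restrict (Ioc (0:ℝ) 1)).prod (volume.restrict (Ioc (0:ℝ) (2*π)))) :=
  (lintegral_prod _ (hf.aemeasurable_weight_mul_norm_sq a)).symm

theorem weightedEnergy_eq_swap (hf : SmoothHalfPlane f) (a : ℝ) :
    weightedEnergy a f = ∫⁻ θ in Ioc (0:ℝ) (2*π), ∫⁻ ψ in Ioc (0:ℝ) 1,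
      ENNReal.ofReal (ψ ^ a * ‖f ψ θ‖ ^ 2) :=
  lintegral_lintegral_swap (hf.aemeasurable_weight_mul_norm_sq a)

end SmoothHalfPlane

theorem weightedEnergy_anti {a b : ℝ} (hab : a ≤ b) (f : ℝ → ℝ → ℂ) :
    weightedEnergy b f ≤ weightedEnergy a f := by
  refine setLIntegral_mono' measurableSet_Ioc fun ψ hψ => lintegral_mono fun θ => ?_
  refine ENNReal.ofReal_le_ofReal (mul_le_mul_of_nonneg_right ?_ (sq_nonneg _))
  exact Real.rpow_le_rpow_of_exponent_ge hψ.1 hψ.2 hab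

theorem weightedEnergy_le_sum {ι : Type*} (s : Finset ι) (c : ι → ℂ) {F : ℝ → ℝ → ℂ}
    {f : ι → ℝ → ℝ → ℂ} (hf : ∀ k ∈ s, SmoothHalfPlane (f k))
    (hF : ∀ ψ, 0 < ψ → ∀ θ, F ψ θ = ∑ k ∈ s, c k * f k ψ θ) (a : ℝ) :
    weightedEnergy a F ≤
      ∑ k ∈ s, ENNReal.ofReal (s.card * ‖c k‖ ^ 2) * weightedEnergy a (f k) := by
  have hm := fun k hk => (hf k hk).aemeasurable_weight_mul_norm_sq a
  calc weightedEnergy a F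
      ≤ ∫⁻ ψ in Ioc (0:ℝ) 1, ∫⁻ θ in Ioc (0:ℝ) (2*π), ∑ k ∈ s,
          ENNReal.ofReal (s.card * ‖c k‖ ^ 2) * ENNReal.ofReal (ψ ^ a * ‖f k ψ θ‖ ^ 2) := by
        refine setLIntegral_mono' measurableSet_Ioc fun ψ hψ => lintegral_mono fun θ => ?_
        have hw : 0 ≤ ψ ^ a := Real.rpow_nonneg hψ.1.le _
        simp_rw [← ENNReal.ofReal_mul (show 0 ≤ (s.card : ℝ) * ‖c _‖ ^ 2 by positivity)]
        rw [← ENNReal.ofReal_sum_of_nonneg fun k _ => by positivity]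
        apply ENNReal.ofReal_le_ofReal
        have h1 : ‖F ψ θ‖ ^ 2 ≤ s.card * ∑ k ∈ s, (‖c k‖ * ‖f k ψ θ‖) ^ 2 := by
          rw [hF ψ hψ.1 θ]
          refine (pow_le_pow_left₀ (norm_nonneg _) (norm_sum_le _ _) 2).trans ?_
          simp_rw [norm_mul]
          exact sq_sum_le_card_mul_sum_sq
        refine (mul_le_mul_of_nonneg_left h1 hw).trans_eq ?_
        rw [Finset.mul_sum, Finset.mul_sum]
        exact Finset.sum_congr rfl fun k _ => by ring
    _ = ∑ k ∈ s, ENNReal.ofReal (s.card * ‖c k‖ ^ 2) * weightedEnergy a (f k) := by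
        rw [← lintegral_prod (fun z : ℝ × ℝ => ∑ k ∈ s, ENNReal.ofReal (s.card * ‖c k‖ ^ 2) *
            ENNReal.ofReal (z.1 ^ a * ‖f k z.1 z.2‖ ^ 2))
          (Finset.aemeasurable_fun_sum s fun k hk => (hm k hk).const_mul _),
          lintegral_finsetSum' _ fun k hk => (hm k hk).const_mul _]
        refine Finset.sum_congr rfl fun k hk => ?_
        rw [lintegral_const_mul' _ _ ENNReal.ofReal_ne_top,
          (hf k hk).weightedEnergy_eq_lintegral_prod]

namespace SmoothHalfPlane

variable {u v : ℝ → ℝ → ℂ}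

theorem sliceEnergy_pder_le (hu : SmoothHalfPlane u) (a : ℝ) (p q : ℕ) {ψ : ℝ} (hψ : 0 < ψ)
    (hψ1 : ψ ≤ 1) :
    sliceEnergy (a + 1) (pder p q u) ψ ≤ ENNReal.ofReal (4 * 2 ^ |a| + 2 ^ |a + 2|) *
      (weightedEnergy a (pder p q u) + weightedEnergy (a + 2) (pder (p + 1) q u)) := by
  have hm : AEMeasurable
      (fun θ => ∫⁻ s in Ioc (0:ℝ) 1, ENNReal.ofReal (s ^ a * ‖pder p q u s θ‖ ^ 2))
      (volume.restrict (Ioc (0:ℝ) (2*π))) :=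
    ((hu.smooth_pder p q).aemeasurable_weight_mul_norm_sq a).prod_swap.lintegral_prod_right'
  rw [(hu.smooth_pder p q).weightedEnergy_eq_swap,
    (hu.smooth_pder (p + 1) q).weightedEnergy_eq_swap,
    ← lintegral_add_left' hm,
    ← lintegral_const_mul' _ _ ENNReal.ofReal_ne_top]
  refine lintegral_mono fun θ => ?_
  refine weighted_sup_le a (fun s hs => hu.hasDerivAt_pder_left p q hs θ) ?_ hψ hψ1
  intro s hs
  exact ((hu.smooth_pder (p + 1) q).contDiffAt_left hs θ).continuousAt.continuousWithinAt

theorem pder_le_sliceEnergy (hu : SmoothHalfPlane u) (a : ℝ) (p q : ℕ) {ψ : ℝ} (hψ : 0 < ψ)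
    {θ : ℝ} (hθ : θ ∈ Ioc 0 (2*π)) :
    ENNReal.ofReal (ψ ^ a * ‖pder p q u ψ θ‖ ^ 2) ≤ ENNReal.ofReal (4 * π) *
      (sliceEnergy a (pder p q u) ψ + sliceEnergy a (pder p (q + 1) u) ψ) := by
  have key := ofReal_length_mul_norm_sq_le (a := 0) (b := 2 * π)
    (fun t _ => hu.hasDerivAt_pder_right p q hψ t)
    (fun t _ => ((hu.smooth_pder p (q + 1)).contDiffAt_right hψ t).continuousAt.continuousWithinAt)
    (Ioc_subset_Icc_self hθ)
  have hw : 0 ≤ ψ ^ a := Real.rpow_nonneg hψ.le _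
  have hπ : 0 < π := Real.pi_pos
  have hs : ∀ h : ℝ → ℝ → ℂ, sliceEnergy a h ψ
      = ENNReal.ofReal (ψ ^ a) * ∫⁻ t in Ioc (0:ℝ) (2*π), ENNReal.ofReal (‖h ψ t‖ ^ 2) := by
    intro h
    rw [← lintegral_const_mul' _ _ ENNReal.ofReal_ne_top]
    simp_rw [← ENNReal.ofReal_mul hw]
    rfl
  have e1 : ENNReal.ofReal (ψ ^ a * ‖pder p q u ψ θ‖ ^ 2)
      = ENNReal.ofReal (ψ ^ a / (2 * π)) *
        ENNReal.ofReal ((2 * π - 0) * ‖pder p q u ψ θ‖ ^ 2) := by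
    rw [← ENNReal.ofReal_mul (by positivity)]
    congr 1
    field_simp
    ring
  rw [e1]
  refine (mul_le_mul_right key _).trans ?_
  rw [hs, hs, mul_add, mul_add, ← mul_assoc, ← mul_assoc, ← mul_assoc, ← mul_assoc,
    ← ENNReal.ofReal_mul (by positivity), ← ENNReal.ofReal_mul (by positivity),
    ← ENNReal.ofReal_mul (by positivity)]
  have c1 : ψ ^ a / (2 * π) * 2 ≤ 4 * π * ψ ^ a := by
    have : 1 ≤ 4 * π * π := by nlinarith [Real.pi_gt_three]
    rw [div_mul_eq_mul_div, div_le_iff₀ (by positivity)]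
    nlinarith
  have c2 : ψ ^ a / (2 * π) * (2 * (2 * π - 0) ^ 2) ≤ 4 * π * ψ ^ a := by
    apply le_of_eq
    field_simp
    ring
  gcongr

theorem weight_mul_norm_sq_mul (a b : ℝ) {ψ : ℝ} (hψ : 0 < ψ) (z w : ℂ) :
    ENNReal.ofReal (ψ ^ (a + b) * ‖z * w‖ ^ 2) =
      ENNReal.ofReal (ψ ^ a * ‖z‖ ^ 2) * ENNReal.ofReal (ψ ^ b * ‖w‖ ^ 2) := by
  rw [← ENNReal.ofReal_mul (by positivity), Real.rpow_add hψ, norm_mul]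
  congr 1; ring

/-- Product estimate with one factor bounded in `L²_ψ L^∞_θ` and the other in
`L^∞_ψ L²_θ`. -/
theorem weightedEnergy_mul_le_mixed (hu : SmoothHalfPlane u) (hv : SmoothHalfPlane v) (a b : ℝ)
    (p q p' q' : ℕ) :
    weightedEnergy (a + (b + 1)) (fun ψ θ => pder p q u ψ θ * pder p' q' v ψ θ) ≤
      ENNReal.ofReal (4 * π) *
        (weightedEnergy a (pder p q u) + weightedEnergy a (pder p (q + 1) u)) *
        (ENNReal.ofReal (4 * 2 ^ |b| + 2 ^ |b + 2|) *
          (weightedEnergy b (pder p' q' v) + weightedEnergy (b + 2) (pder (p' + 1) q' v))) := by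
  have hm1 := (hu.smooth_pder p q).aemeasurable_sliceEnergy a
  have hm2 := (hu.smooth_pder p (q + 1)).aemeasurable_sliceEnergy a
  have hm : AEMeasurable (fun ψ => ENNReal.ofReal (4 * π) *
      (sliceEnergy a (pder p q u) ψ + sliceEnergy a (pder p (q + 1) u) ψ))
      (volume.restrict (Ioc (0:ℝ) 1)) := (hm1.add hm2).const_mul _
  rw [← lintegral_sliceEnergy a (pder p q u), ← lintegral_sliceEnergy a (pder p (q + 1) u),
    ← lintegral_add_left' hm1, ← lintegral_const_mul' _ _ ENNReal.ofReal_ne_top,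
    ← lintegral_mul_const'' _ hm]
  refine setLIntegral_mono' measurableSet_Ioc fun ψ hψ => ?_
  refine le_trans ?_ (mul_le_mul_right (hv.sliceEnergy_pder_le b p' q' hψ.1 hψ.2) _)
  rw [sliceEnergy.eq_1 (b + 1),
    ← lintegral_const_mul'' _ ((hv.smooth_pder p' q').aemeasurable_slice _ hψ.1)]
  refine setLIntegral_mono' measurableSet_Ioc fun θ hθ => ?_
  rw [weight_mul_norm_sq_mul _ _ hψ.1]
  exact mul_le_mul_left (hu.pder_le_sliceEnergy a p q hψ.1 hθ) _

/-- Product estimate with the second factor bounded uniformly. -/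
theorem weightedEnergy_mul_le_sup (hu : SmoothHalfPlane u) (hv : SmoothHalfPlane v) (a b : ℝ)
    (p q p' q' : ℕ) :
    weightedEnergy (a + (b + 1)) (fun ψ θ => pder p q u ψ θ * pder p' q' v ψ θ) ≤
      weightedEnergy a (pder p q u) * (ENNReal.ofReal (4 * π) *
        (ENNReal.ofReal (4 * 2 ^ |b| + 2 ^ |b + 2|) *
            (weightedEnergy b (pder p' q' v) + weightedEnergy (b + 2) (pder (p' + 1) q' v)) +
          ENNReal.ofReal (4 * 2 ^ |b| + 2 ^ |b + 2|) *
            (weightedEnergy b (pder p' (q' + 1) v) +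
              weightedEnergy (b + 2) (pder (p' + 1) (q' + 1) v)))) := by
  have hm := (hu.smooth_pder p q).aemeasurable_sliceEnergy a
  rw [← lintegral_sliceEnergy a (pder p q u), ← lintegral_mul_const'' _ hm]
  refine setLIntegral_mono' measurableSet_Ioc fun ψ hψ => ?_
  rw [sliceEnergy, ← lintegral_mul_const'' _ ((hu.smooth_pder p q).aemeasurable_slice _ hψ.1)]
  refine setLIntegral_mono' measurableSet_Ioc fun θ hθ => ?_
  rw [weight_mul_norm_sq_mul _ _ hψ.1]
  refine mul_le_mul_right ((hv.pder_le_sliceEnergy (b + 1) p' q' hψ.1 hθ).trans ?_) _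
  refine mul_le_mul_right (add_le_add ?_ ?_) _
  · exact hv.sliceEnergy_pder_le b p' q' hψ.1 hψ.2
  · exact hv.sliceEnergy_pder_le b p' (q' + 1) hψ.1 hψ.2

end SmoothHalfPlane

theorem weightedEnergy_pder_le_KNormSq (γ : ℝ) {m p q : ℕ} (h : p + q ≤ m) (u : ℝ → ℝ → ℂ)
    {a : ℝ} (ha : a = 2 * ((p:ℝ) - γ)) :
    weightedEnergy a (pder p q u) ≤ KNormSq γ m u := by
  subst ha
  have h1 : p ∈ Finset.range (m + 1) := Finset.mem_range.2 (by omega)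
  have h2 : q ∈ Finset.range (m + 1 - p) := Finset.mem_range.2 (by omega)
  refine le_trans ?_ (Finset.single_le_sum (f := fun p => ∑ q ∈ Finset.range (m+1-p),
    weightedEnergy (2 * ((p:ℝ) - γ)) (pder p q u)) (fun _ _ => zero_le) h1)
  exact Finset.single_le_sum (f := fun q => weightedEnergy (2 * ((p:ℝ) - γ)) (pder p q u))
    (fun _ _ => zero_le) h2

/-- A constant valid in the weighted product estimates for all orders up to `m`. -/
def productConst (γ : ℝ) (m : ℕ) : ℝ≥0∞ :=
  ENNReal.ofReal (16 * π) * ENNReal.ofReal (8 * 2 ^ (2 * (m + |γ|)))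

theorem sobolevConst_le (γ : ℝ) {m p : ℕ} (hp : p ≤ m) :
    ENNReal.ofReal (4 * 2 ^ |2 * ((p:ℝ) - γ)| + 2 ^ |2 * ((p:ℝ) - γ) + 2|) ≤
      ENNReal.ofReal (8 * 2 ^ (2 * (m + |γ|))) := by
  have hp' : (p:ℝ) ≤ m := by exact_mod_cast hp
  have hp0 : (0:ℝ) ≤ p := p.cast_nonneg
  have h1 : |2 * ((p:ℝ) - γ)| ≤ 2 * (m + |γ|) := by
    rw [abs_mul, abs_two]
    have := abs_sub (p:ℝ) γ
    rw [abs_of_nonneg hp0] at this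
    linarith
  have h2 : |2 * ((p:ℝ) - γ) + 2| ≤ 2 * (m + |γ|) + 2 := by
    have := abs_add_le (2 * ((p:ℝ) - γ)) 2
    rw [abs_two] at this
    linarith
  have e1 : (2:ℝ) ^ |2 * ((p:ℝ) - γ)| ≤ 2 ^ (2 * (m + |γ|)) :=
    Real.rpow_le_rpow_of_exponent_le one_le_two h1
  have e2 : (2:ℝ) ^ |2 * ((p:ℝ) - γ) + 2| ≤ 2 ^ (2 * (m + |γ|)) * 4 := by
    refine (Real.rpow_le_rpow_of_exponent_le one_le_two h2).trans_eq ?_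
    rw [Real.rpow_add two_pos, Real.rpow_two]; norm_num
  apply ENNReal.ofReal_le_ofReal
  linarith

theorem ofReal_sixteen_pi : ENNReal.ofReal (16 * π) = ENNReal.ofReal (4 * π) * 4 := by
  rw [show 16 * π = 4 * π * 4 by ring, ENNReal.ofReal_mul (by positivity)]
  simp

namespace SmoothHalfPlane

variable {u v : ℝ → ℝ → ℂ}

theorem weightedEnergy_mul_le_KNormSq_mixed (hu : SmoothHalfPlane u) (hv : SmoothHalfPlane v)
    {γ : ℝ} (hγ : 1/2 < γ) {m p q p' q' : ℕ} (h : p + q + 1 ≤ m) (h' : p' + q' + 1 ≤ m) :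
    weightedEnergy (2 * (((p + p' : ℕ) : ℝ) - γ)) (fun ψ θ => pder p q u ψ θ * pder p' q' v ψ θ) ≤
      productConst γ m * (KNormSq γ m u * KNormSq γ m v) := by
  refine (weightedEnergy_anti (a := 2 * ((p:ℝ) - γ) + (2 * ((p':ℝ) - γ) + 1)) ?_ _).trans ?_
  · push_cast; linarith
  refine (hu.weightedEnergy_mul_le_mixed hv _ _ p q p' q').trans ?_
  calc _ ≤ ENNReal.ofReal (4 * π) * (KNormSq γ m u + KNormSq γ m u) *
        (ENNReal.ofReal (8 * 2 ^ (2 * (m + |γ|))) * (KNormSq γ m v + KNormSq γ m v)) := by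
        gcongr ENNReal.ofReal (4 * π) * (?_ + ?_) * (?_ * (?_ + ?_))
        · exact weightedEnergy_pder_le_KNormSq γ (by omega) u rfl
        · exact weightedEnergy_pder_le_KNormSq γ (by omega) u rfl
        · exact sobolevConst_le γ (by omega)
        · exact weightedEnergy_pder_le_KNormSq γ (by omega) v rfl
        · exact weightedEnergy_pder_le_KNormSq γ (by omega) v (by push_cast; ring)
    _ = _ := by
        rw [productConst, ofReal_sixteen_pi]
        ring

theorem weightedEnergy_mul_le_KNormSq_sup (hu : SmoothHalfPlane u) (hv : SmoothHalfPlane v)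
    {γ : ℝ} (hγ : 1/2 < γ) {m p q p' q' : ℕ} (h : p + q ≤ m) (h' : p' + q' + 2 ≤ m) :
    weightedEnergy (2 * (((p + p' : ℕ) : ℝ) - γ)) (fun ψ θ => pder p q u ψ θ * pder p' q' v ψ θ) ≤
      productConst γ m * (KNormSq γ m u * KNormSq γ m v) := by
  refine (weightedEnergy_anti (a := 2 * ((p:ℝ) - γ) + (2 * ((p':ℝ) - γ) + 1)) ?_ _).trans ?_
  · push_cast; linarith
  refine (hu.weightedEnergy_mul_le_sup hv _ _ p q p' q').trans ?_
  calc _ ≤ KNormSq γ m u * (ENNReal.ofReal (4 * π) *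
        (ENNReal.ofReal (8 * 2 ^ (2 * (m + |γ|))) * (KNormSq γ m v + KNormSq γ m v) +
          ENNReal.ofReal (8 * 2 ^ (2 * (m + |γ|))) * (KNormSq γ m v + KNormSq γ m v))) := by
        gcongr ?_ * (ENNReal.ofReal (4 * π) * (?_ * (?_ + ?_) + ?_ * (?_ + ?_)))
        · exact weightedEnergy_pder_le_KNormSq γ (by omega) u rfl
        · exact sobolevConst_le γ (by omega)
        · exact weightedEnergy_pder_le_KNormSq γ (by omega) v rfl
        · exact weightedEnergy_pder_le_KNormSq γ (by omega) v (by push_cast; ring)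
        · exact sobolevConst_le γ (by omega)
        · exact weightedEnergy_pder_le_KNormSq γ (by omega) v rfl
        · exact weightedEnergy_pder_le_KNormSq γ (by omega) v (by push_cast; ring)
    _ = _ := by
        rw [productConst, ofReal_sixteen_pi]
        ring

theorem weightedEnergy_mul_le_KNormSq (hu : SmoothHalfPlane u) (hv : SmoothHalfPlane v)
    {γ : ℝ} (hγ : 1/2 < γ) {m p q p' q' : ℕ} (hm : 2 ≤ m) (h : p + q + (p' + q') ≤ m) :
    weightedEnergy (2 * (((p + p' : ℕ) : ℝ) - γ)) (fun ψ θ => pder p q u ψ θ * pder p' q' v ψ θ) ≤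
      productConst γ m * (KNormSq γ m u * KNormSq γ m v) := by
  by_cases h1 : p' + q' + 2 ≤ m
  · exact hu.weightedEnergy_mul_le_KNormSq_sup hv hγ (by omega) h1
  by_cases h2 : p + q + 2 ≤ m
  · rw [mul_comm (KNormSq γ m u), add_comm p p']
    simp_rw [mul_comm (pder p q u _ _)]
    exact hv.weightedEnergy_mul_le_KNormSq_sup hu hγ (by omega) h2
  · exact hu.weightedEnergy_mul_le_KNormSq_mixed hv hγ (by omega) (by omega)

theorem weightedEnergy_pder_mul_le (hu : SmoothHalfPlane u) (hv : SmoothHalfPlane v)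
    {γ : ℝ} (hγ : 1/2 < γ) {m p q : ℕ} (hm : 2 ≤ m) (h : p + q ≤ m) :
    weightedEnergy (2 * ((p:ℝ) - γ)) (pder p q (fun ψ θ => u ψ θ * v ψ θ)) ≤
      (∑ k ∈ Finset.range (q + 1) ×ˢ Finset.range (p + 1),
        ENNReal.ofReal ((Finset.range (q + 1) ×ˢ Finset.range (p + 1)).card *
          ‖(q.choose k.1 : ℂ) * (p.choose k.2 : ℂ)‖ ^ 2) * productConst γ m) *
        (KNormSq γ m u * KNormSq γ m v) := by
  refine (weightedEnergy_le_sum (Finset.range (q + 1) ×ˢ Finset.range (p + 1))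
    (fun k => (q.choose k.1 : ℂ) * (p.choose k.2 : ℂ))
    (f := fun k ψ θ => pder k.2 k.1 u ψ θ * pder (p - k.2) (q - k.1) v ψ θ)
    (fun k _ => (hu.smooth_pder _ _).mul (hv.smooth_pder _ _)) (fun ψ hψ θ => ?_) _).trans ?_
  · rw [hu.pder_mul_eq_sum hv p q hψ θ, Finset.sum_product]
  · rw [Finset.sum_mul]
    refine Finset.sum_le_sum fun k hk => ?_
    rw [Finset.mem_product, Finset.mem_range, Finset.mem_range] at hk
    rw [mul_assoc]
    refine mul_le_mul_right ?_ _
    have := hu.weightedEnergy_mul_le_KNormSq hv hγ (m := m) (p := k.2) (q := k.1) (p' := p - k.2)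
      (q' := q - k.1) hm (by omega)
    rwa [Nat.add_sub_cancel' (by omega)] at this

end SmoothHalfPlane

theorem exists_KNormSq_mul_le {m : ℕ} (hm : 2 ≤ m) {γ : ℝ} (hγ : 1/2 < γ) :
    ∃ C : ℝ≥0∞, C ≠ ⊤ ∧ ∀ u v : ℝ → ℝ → ℂ, SmoothHalfPlane u → SmoothHalfPlane v →
      KNormSq γ m (fun ψ θ => u ψ θ * v ψ θ) ≤ C * (KNormSq γ m u * KNormSq γ m v) := by
  refine ⟨∑ p ∈ Finset.range (m+1), ∑ q ∈ Finset.range (m+1-p),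
    ∑ k ∈ Finset.range (q + 1) ×ˢ Finset.range (p + 1),
      ENNReal.ofReal ((Finset.range (q + 1) ×ˢ Finset.range (p + 1)).card *
        ‖(q.choose k.1 : ℂ) * (p.choose k.2 : ℂ)‖ ^ 2) * productConst γ m, ?_, ?_⟩
  · refine ENNReal.sum_ne_top.2 fun p _ => ENNReal.sum_ne_top.2 fun q _ =>
      ENNReal.sum_ne_top.2 fun k _ => ENNReal.mul_ne_top ENNReal.ofReal_ne_top ?_
    exact ENNReal.mul_ne_top ENNReal.ofReal_ne_top ENNReal.ofReal_ne_top
  · intro u v hu hv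
    rw [Finset.sum_mul]
    refine Finset.sum_le_sum fun p hp => ?_
    rw [Finset.sum_mul]
    refine Finset.sum_le_sum fun q hq => ?_
    rw [Finset.mem_range] at hp hq
    exact hu.weightedEnergy_pder_mul_le hv hγ hm (by omega)

/-- **`K_γ^m(Π)` is an algebra** for `m ≥ 2`, `γ > 1/2`:
`‖uv‖_{K_γ^m} ≤ C ‖u‖_{K_γ^m} ‖v‖_{K_γ^m}`. -/
theorem kondratev_algebra (m : ℕ) (hm : 2 ≤ m) (γ : ℝ) (hγ : 1/2 < γ) :
    ∃ C > 0, ∀ u v : ℝ → ℝ → ℂ, SmoothAnn u → SmoothAnn v →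
      KNorm γ m u ≠ ⊤ → KNorm γ m v ≠ ⊤ →
      KNorm γ m (fun ψ θ => u ψ θ * v ψ θ) ≤
        ENNReal.ofReal C * KNorm γ m u * KNorm γ m v := by
  obtain ⟨C, hC, h⟩ := exists_KNormSq_mul_le hm hγ
  refine ⟨(C ^ ((1:ℝ)/2)).toReal + 1, by positivity, fun u v hu hv _ _ => ?_⟩
  refine (ENNReal.rpow_le_rpow (h u v hu.1 hv.1) (by norm_num)).trans ?_
  rw [ENNReal.mul_rpow_of_nonneg _ _ (by norm_num), ENNReal.mul_rpow_of_nonneg _ _ (by norm_num),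
    ← mul_assoc]
  have hC' : C ^ ((1:ℝ)/2) ≤ ENNReal.ofReal ((C ^ ((1:ℝ)/2)).toReal + 1) := by
    refine le_trans ?_ (ENNReal.ofReal_le_ofReal (le_add_of_nonneg_right zero_le_one))
    rw [ENNReal.ofReal_toReal (ENNReal.rpow_ne_top_of_nonneg (by norm_num) hC)]
  exact mul_le_mul_left (mul_le_mul_left hC' _) _
end
end

section
/- Let m ≥ 1 be an integer and γ a real number. Then there exists a constant C > 0 such that for every smooth function ξ : 𝕋 → ℂ and every smooth function u : (0,1] × 𝕋 → ℂ with ‖u‖_{K_γ^m} < ∞, the product (ψ,θ) ↦ ξ(θ) u(ψ,θ) satisfies ‖ξ u‖_{K_γ^m} ≤ C ‖ξ‖_{H^m(𝕋)} ‖u‖_{K_γ^m}. -/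
open MeasureTheory Real Set ENNReal

noncomputable section

/-- The Sobolev norm `‖ξ‖_{H^m(𝕋)}` of a function on the circle:
`‖ξ‖²_{H^m} = Σ_{q=0}^m ∫_𝕋 |D^q ξ|² dθ`. -/
def HNormC (m : ℕ) (ξ : ℝ → ℂ) : ℝ≥0∞ :=
  (∑ q ∈ Finset.range (m+1), ∫⁻ θ in Ioc (0:ℝ) (2*π),
    ENNReal.ofReal (‖iteratedDeriv q ξ θ‖^2)) ^ ((1:ℝ)/2)

lemma contDiffOn_partial_snd {F : ℝ → ℝ → ℂ}
    (hF : ContDiffOn ℝ (⊤ : ℕ∞) (Function.uncurry F) (Ioi (0:ℝ) ×ˢ (univ : Set ℝ))) (q : ℕ) :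
    ContDiffOn ℝ (⊤ : ℕ∞) (Function.uncurry fun ψ θ => iteratedDeriv q (F ψ) θ)
      (Ioi (0:ℝ) ×ˢ (univ : Set ℝ)) := by
  have ho : IsOpen (Ioi (0:ℝ) ×ˢ (univ : Set ℝ)) := isOpen_Ioi.prod isOpen_univ
  induction q with
  | zero => simpa using hF
  | succ q ih =>
    have hd := (ih.fderiv_of_isOpen ho (m := (⊤ : ℕ∞)) (by simp)).clm_apply
      (contDiffOn_const (c := ((0:ℝ), (1:ℝ))))
    refine hd.congr ?_
    rintro ⟨ψ, θ⟩ hx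
    have h1 := ((ih.differentiableOn (by simp)).differentiableAt (ho.mem_nhds hx)).hasFDerivAt
    have h2 : HasDerivAt (fun t : ℝ => (ψ, t)) ((0:ℝ), (1:ℝ)) θ :=
      (hasDerivAt_const θ ψ).prodMk (hasDerivAt_id θ)
    have h3 := h1.comp_hasDerivAt θ h2
    simp only [Function.uncurry, iteratedDeriv_succ]
    exact h3.deriv

lemma contDiffOn_partial_fst {F : ℝ → ℝ → ℂ}
    (hF : ContDiffOn ℝ (⊤ : ℕ∞) (Function.uncurry F) (Ioi (0:ℝ) ×ˢ (univ : Set ℝ))) (p : ℕ) :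
    ContDiffOn ℝ (⊤ : ℕ∞) (Function.uncurry fun ψ θ => iteratedDeriv p (fun s => F s θ) ψ)
      (Ioi (0:ℝ) ×ˢ (univ : Set ℝ)) := by
  have ho : IsOpen (Ioi (0:ℝ) ×ˢ (univ : Set ℝ)) := isOpen_Ioi.prod isOpen_univ
  induction p with
  | zero => simpa using hF
  | succ p ih =>
    have hd := (ih.fderiv_of_isOpen ho (m := (⊤ : ℕ∞)) (by simp)).clm_apply
      (contDiffOn_const (c := ((1:ℝ), (0:ℝ))))
    refine hd.congr ?_
    rintro ⟨ψ, θ⟩ hx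
    have h1 := ((ih.differentiableOn (by simp)).differentiableAt (ho.mem_nhds hx)).hasFDerivAt
    have h2 : HasDerivAt (fun t : ℝ => (t, θ)) ((1:ℝ), (0:ℝ)) ψ :=
      (hasDerivAt_id ψ).prodMk (hasDerivAt_const ψ θ)
    have h3 := h1.comp_hasDerivAt ψ h2
    simp only [Function.uncurry, iteratedDeriv_succ]
    exact h3.deriv

lemma contDiffOn_pder {u : ℝ → ℝ → ℂ}
    (hu : ContDiffOn ℝ (⊤ : ℕ∞) (Function.uncurry u) (Ioi (0:ℝ) ×ˢ (univ : Set ℝ))) (p q : ℕ) :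
    ContDiffOn ℝ (⊤ : ℕ∞) (Function.uncurry (pder p q u)) (Ioi (0:ℝ) ×ˢ (univ : Set ℝ)) :=
  contDiffOn_partial_fst (contDiffOn_partial_snd hu q) p

lemma ContDiffOn.contDiff_slice_snd {F : ℝ → ℝ → ℂ}
    (hF : ContDiffOn ℝ (⊤ : ℕ∞) (Function.uncurry F) (Ioi (0:ℝ) ×ˢ (univ : Set ℝ)))
    {ψ : ℝ} (hψ : 0 < ψ) : ContDiff ℝ (⊤ : ℕ∞) (F ψ) := by
  rw [← contDiffOn_univ]
  exact hF.comp (contDiff_prodMk_right ψ).contDiffOn (fun _ _ => ⟨hψ, mem_univ _⟩)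

lemma ContDiffOn.contDiffAt_slice_fst {F : ℝ → ℝ → ℂ}
    (hF : ContDiffOn ℝ (⊤ : ℕ∞) (Function.uncurry F) (Ioi (0:ℝ) ×ˢ (univ : Set ℝ)))
    {ψ : ℝ} (hψ : 0 < ψ) (θ : ℝ) : ContDiffAt ℝ (⊤ : ℕ∞) (fun s => F s θ) ψ := by
  have h : ContDiffOn ℝ (⊤ : ℕ∞) (fun s => F s θ) (Ioi 0) :=
    hF.comp (contDiff_prodMk_left θ).contDiffOn (fun _ hs => ⟨hs, mem_univ _⟩)
  exact h.contDiffAt (Ioi_mem_nhds hψ)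

/-- The Leibniz rule for multiplication by a function of `θ` alone. -/
lemma pder_mul {ξ : ℝ → ℂ} (hξ : ContDiff ℝ (⊤ : ℕ∞) ξ) {u : ℝ → ℝ → ℂ}
    (hu : ContDiffOn ℝ (⊤ : ℕ∞) (Function.uncurry u) (Ioi (0:ℝ) ×ˢ (univ : Set ℝ)))
    (p q : ℕ) {ψ : ℝ} (hψ : 0 < ψ) (θ : ℝ) :
    pder p q (fun ψ θ => ξ θ * u ψ θ) ψ θ = ∑ k ∈ Finset.range (q+1),
      (q.choose k * iteratedDeriv k ξ θ) * pder p (q-k) u ψ θ := by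
  have key : (fun s => iteratedDeriv q (fun θ => ξ θ * u s θ) θ) =ᶠ[nhds ψ]
      fun s => ∑ k ∈ Finset.range (q+1),
        (q.choose k * iteratedDeriv k ξ θ) * iteratedDeriv (q-k) (u s) θ := by
    filter_upwards [Ioi_mem_nhds hψ] with s hs
    exact iteratedDeriv_mul (hξ.contDiffAt.of_le (mod_cast le_top))
      ((hu.contDiff_slice_snd hs).contDiffAt.of_le (mod_cast le_top))
  have hs : ∀ j, ContDiffAt ℝ p (fun s => iteratedDeriv j (u s) θ) ψ := fun j =>
    ((contDiffOn_partial_snd hu j).contDiffAt_slice_fst hψ θ).of_le (mod_cast le_top)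
  unfold pder
  rw [key.iteratedDeriv_eq, iteratedDeriv_fun_sum (fun k _ => contDiffAt_const.mul (hs _))]
  exact Finset.sum_congr rfl fun k _ => iteratedDeriv_const_mul _ (hs _)

lemma lintegral_sq_norm_eq_ofReal {g : ℝ → ℂ} (hg : Continuous g) :
    ∫⁻ θ in Ioc (0:ℝ) (2*π), ENNReal.ofReal (‖g θ‖^2) =
      ENNReal.ofReal (∫ θ in Ioc (0:ℝ) (2*π), ‖g θ‖^2) :=
  (ofReal_integral_eq_lintegral_ofReal
    ((by fun_prop : Continuous fun θ => ‖g θ‖^2).integrableOn_Ioc)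
    (ae_of_all _ fun _ => by positivity)).symm

/-- The one-dimensional Sobolev embedding `H¹(0,2π) ⊂ L^∞`. -/
lemma ofReal_sq_norm_le_sobolev {g : ℝ → ℂ} (hg : ContDiff ℝ 1 g) {θ : ℝ}
    (hθ : θ ∈ Ioc (0:ℝ) (2*π)) :
    ENNReal.ofReal (‖g θ‖^2) ≤
      2 * ((∫⁻ t in Ioc (0:ℝ) (2*π), ENNReal.ofReal (‖g t‖^2)) +
        ∫⁻ t in Ioc (0:ℝ) (2*π), ENNReal.ofReal (‖deriv g t‖^2)) := by
  have hgc : Continuous g := hg.continuous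
  have hdc : Continuous (deriv g) := hg.continuous_deriv le_rfl
  have hpi : (3:ℝ) < π := Real.pi_gt_three
  rw [lintegral_sq_norm_eq_ofReal hgc, lintegral_sq_norm_eq_ofReal hdc]
  set a := ∫ t in Ioc (0:ℝ) (2*π), ‖g t‖^2
  set b := ∫ t in Ioc (0:ℝ) (2*π), ‖deriv g t‖^2
  have ha0 : 0 ≤ a := integral_nonneg fun _ => by positivity
  have hb0 : 0 ≤ b := integral_nonneg fun _ => by positivity
  have hia : IntegrableOn (fun t => ‖g t‖^2) (Ioc (0:ℝ) (2*π)) :=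
    (by fun_prop : Continuous fun t => ‖g t‖^2).integrableOn_Ioc
  have hib : IntegrableOn (fun t => ‖deriv g t‖^2) (Ioc (0:ℝ) (2*π)) :=
    (by fun_prop : Continuous fun t => ‖deriv g t‖^2).integrableOn_Ioc
  have hD : Continuous fun x => 2 * inner ℝ (g x) (deriv g x) := by fun_prop
  have hder : ∀ x, HasDerivAt (fun x => ‖g x‖^2) (2 * inner ℝ (g x) (deriv g x)) x := fun x =>
    ((hg.differentiable one_ne_zero x).hasDerivAt).norm_sq
  have hosc : ∀ t ∈ Ioc (0:ℝ) (2*π), ‖g θ‖^2 - (a + b) ≤ ‖g t‖^2 := by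
    intro t ht
    have h1 : ∫ x in t..θ, 2 * inner ℝ (g x) (deriv g x) = ‖g θ‖^2 - ‖g t‖^2 :=
      intervalIntegral.integral_eq_sub_of_hasDerivAt (fun x _ => hder x)
        (hD.intervalIntegrable _ _)
    have hsub : uIoc t θ ⊆ Ioc (0:ℝ) (2*π) := fun x hx => by
      rw [mem_uIoc] at hx
      rcases hx with hx | hx
      · exact ⟨ht.1.trans hx.1, hx.2.trans hθ.2⟩
      · exact ⟨hθ.1.trans hx.1, hx.2.trans ht.2⟩
    have h2 : ∫ x in uIoc t θ, ‖2 * inner ℝ (g x) (deriv g x)‖ ≤ a + b := by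
      calc _ ≤ ∫ x in Ioc (0:ℝ) (2*π), ‖2 * inner ℝ (g x) (deriv g x)‖ :=
            setIntegral_mono_set hD.norm.integrableOn_Ioc
              (ae_of_all _ fun _ => norm_nonneg _) hsub.eventuallyLE
        _ ≤ ∫ x in Ioc (0:ℝ) (2*π), (‖g x‖^2 + ‖deriv g x‖^2) := by
            refine integral_mono hD.norm.integrableOn_Ioc (hia.add hib) fun x => ?_
            have := norm_inner_le_norm (𝕜 := ℝ) (g x) (deriv g x)
            simp only [norm_mul, Real.norm_ofNat]
            nlinarith [sq_nonneg (‖g x‖ - ‖deriv g x‖)]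
        _ = a + b := integral_add hia hib
    have h3 := (le_abs_self _).trans
      ((intervalIntegral.norm_integral_le_integral_norm_uIoc
        (f := fun x => 2 * inner ℝ (g x) (deriv g x)) (μ := volume)
        (a := t) (b := θ)).trans h2)
    rw [h1] at h3
    linarith
  have hmean : (2*π) * (‖g θ‖^2 - (a + b)) ≤ a := by
    have h := setIntegral_mono_on (μ := volume) (f := fun _ => ‖g θ‖^2 - (a + b))
      (continuous_const.integrableOn_Ioc) hia measurableSet_Ioc hosc
    simpa [Real.pi_pos.le] using h
  have hfin : ‖g θ‖^2 ≤ 2 * (a + b) := by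
    by_contra! hlt
    nlinarith
  calc ENNReal.ofReal (‖g θ‖^2) ≤ ENNReal.ofReal (2 * (a + b)) := ENNReal.ofReal_le_ofReal hfin
    _ = _ := by
      rw [ENNReal.ofReal_mul two_pos.le, ENNReal.ofReal_add ha0 hb0, ENNReal.ofReal_ofNat]

/-- The angular part of the terms of `KNormSq`. -/
def angularEnergy (γ : ℝ) (p q : ℕ) (u : ℝ → ℝ → ℂ) (ψ : ℝ) : ℝ≥0∞ :=
  ∫⁻ θ in Ioc (0:ℝ) (2*π), ENNReal.ofReal (ψ ^ (2*((p:ℝ) - γ)) * ‖pder p q u ψ θ‖^2)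

/-- The sum of the angular energies of all orders up to `m`. -/
def totalEnergy (γ : ℝ) (m : ℕ) (u : ℝ → ℝ → ℂ) (ψ : ℝ) : ℝ≥0∞ :=
  ∑ p ∈ Finset.range (m+1), ∑ q ∈ Finset.range (m+1-p), angularEnergy γ p q u ψ

/-- The square of `HNormC`. -/
def HNormSq (m : ℕ) (ξ : ℝ → ℂ) : ℝ≥0∞ :=
  ∑ q ∈ Finset.range (m+1), ∫⁻ θ in Ioc (0:ℝ) (2*π), ENNReal.ofReal (‖iteratedDeriv q ξ θ‖^2)

lemma angularEnergy_le_totalEnergy (γ : ℝ) {m p q : ℕ} (h : p + q ≤ m) (u : ℝ → ℝ → ℂ) (ψ : ℝ) :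
    angularEnergy γ p q u ψ ≤ totalEnergy γ m u ψ := by
  unfold totalEnergy
  refine le_trans ?_ (Finset.single_le_sum
    (f := fun p => ∑ q ∈ Finset.range (m+1-p), angularEnergy γ p q u ψ)
    (fun _ _ => zero_le) (Finset.mem_range.2 (by omega : p < m+1)))
  exact Finset.single_le_sum (f := fun q => angularEnergy γ p q u ψ)
    (fun _ _ => zero_le) (Finset.mem_range.2 (by omega : q < m+1-p))

lemma lintegral_le_HNormSq {m q : ℕ} (h : q ≤ m) (ξ : ℝ → ℂ) :
    ∫⁻ θ in Ioc (0:ℝ) (2*π), ENNReal.ofReal (‖iteratedDeriv q ξ θ‖^2) ≤ HNormSq m ξ :=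
  Finset.single_le_sum
    (f := fun q => ∫⁻ θ in Ioc (0:ℝ) (2*π), ENNReal.ofReal (‖iteratedDeriv q ξ θ‖^2))
    (fun _ _ => zero_le) (Finset.mem_range.2 (by omega : q < m+1))

lemma HNormSq_ne_top (m : ℕ) {ξ : ℝ → ℂ} (hξ : ContDiff ℝ (⊤ : ℕ∞) ξ) : HNormSq m ξ ≠ ⊤ := by
  refine ENNReal.sum_ne_top.2 fun q _ => ?_
  rw [lintegral_sq_norm_eq_ofReal (hξ.continuous_iteratedDeriv q (mod_cast le_top))]
  exact ENNReal.ofReal_ne_top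

lemma aemeasurable_angularEnergy (γ : ℝ) (p q : ℕ) {u : ℝ → ℝ → ℂ}
    (hu : ContDiffOn ℝ (⊤ : ℕ∞) (Function.uncurry u) (Ioi (0:ℝ) ×ˢ (univ : Set ℝ))) :
    AEMeasurable (angularEnergy γ p q u) (volume.restrict (Ioc (0:ℝ) 1)) := by
  have hc : ContinuousOn (fun x : ℝ × ℝ =>
      ENNReal.ofReal (x.1 ^ (2*((p:ℝ) - γ)) * ‖Function.uncurry (pder p q u) x‖^2))
      (Ioc (0:ℝ) 1 ×ˢ Ioc (0:ℝ) (2*π)) := by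
    refine ENNReal.continuous_ofReal.comp_continuousOn (ContinuousOn.mul ?_ ?_)
    · exact continuousOn_fst.rpow_const fun x hx => Or.inl hx.1.1.ne'
    · exact (((contDiffOn_pder hu p q).continuousOn.mono
        (prod_mono (fun _ h => h.1) (subset_univ _))).norm).pow 2
  have hm := hc.aemeasurable (μ := (volume : Measure ℝ).prod volume)
    (measurableSet_Ioc.prod measurableSet_Ioc)
  rw [← Measure.prod_restrict] at hm
  exact hm.lintegral_prod_right'

lemma lintegral_totalEnergy (γ : ℝ) (m : ℕ) {u : ℝ → ℝ → ℂ}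
    (hu : ContDiffOn ℝ (⊤ : ℕ∞) (Function.uncurry u) (Ioi (0:ℝ) ×ˢ (univ : Set ℝ))) :
    ∫⁻ ψ in Ioc (0:ℝ) 1, totalEnergy γ m u ψ = KNormSq γ m u := by
  unfold totalEnergy KNormSq
  rw [lintegral_finsetSum' _ fun p _ =>
    Finset.aemeasurable_fun_sum _ fun q _ => aemeasurable_angularEnergy γ p q hu]
  refine Finset.sum_congr rfl fun p _ => ?_
  rw [lintegral_finsetSum' _ fun q _ => aemeasurable_angularEnergy γ p q hu]
  rfl

/-- Each term of the Leibniz expansion is controlled by the product of the energies: the factor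
with fewer derivatives is bounded uniformly in `θ`. -/
lemma lintegral_leibniz_term_le {m : ℕ} (hm : 1 ≤ m) (γ : ℝ) {ξ : ℝ → ℂ}
    (hξ : ContDiff ℝ (⊤ : ℕ∞) ξ) {u : ℝ → ℝ → ℂ}
    (hu : ContDiffOn ℝ (⊤ : ℕ∞) (Function.uncurry u) (Ioi (0:ℝ) ×ˢ (univ : Set ℝ)))
    {p q k : ℕ} (hpq : p + q ≤ m) (hk : k ≤ q) {ψ : ℝ} (hψ : 0 < ψ) :
    ∫⁻ θ in Ioc (0:ℝ) (2*π), ENNReal.ofReal (‖iteratedDeriv k ξ θ‖^2) *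
        ENNReal.ofReal (ψ ^ (2*((p:ℝ) - γ)) * ‖pder p (q-k) u ψ θ‖^2) ≤
      4 * HNormSq m ξ * totalEnergy γ m u ψ := by
  rcases lt_or_ge k m with hkm | hkm
  · have hsup : ∀ θ ∈ Ioc (0:ℝ) (2*π),
        ENNReal.ofReal (‖iteratedDeriv k ξ θ‖^2) ≤ 4 * HNormSq m ξ := by
      intro θ hθ
      have h := ofReal_sq_norm_le_sobolev (g := iteratedDeriv k ξ)
        (by
          rw [iteratedDeriv_eq_iterate]
          exact (hξ.iterate_deriv k).of_le (mod_cast le_top)) hθ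
      rw [← iteratedDeriv_succ] at h
      calc _ ≤ _ := h
        _ ≤ 2 * (HNormSq m ξ + HNormSq m ξ) := by
          gcongr
          · exact lintegral_le_HNormSq hkm.le ξ
          · exact lintegral_le_HNormSq hkm ξ
        _ = 4 * HNormSq m ξ := by ring
    calc _ ≤ ∫⁻ θ in Ioc (0:ℝ) (2*π), 4 * HNormSq m ξ *
          ENNReal.ofReal (ψ ^ (2*((p:ℝ) - γ)) * ‖pder p (q-k) u ψ θ‖^2) :=
          setLIntegral_mono' measurableSet_Ioc fun θ hθ => by gcongr; exact hsup θ hθ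
      _ = 4 * HNormSq m ξ * angularEnergy γ p (q-k) u ψ :=
          lintegral_const_mul' _ _ (ENNReal.mul_ne_top (by simp) (HNormSq_ne_top m hξ))
      _ ≤ _ := by gcongr; exact angularEnergy_le_totalEnergy γ (by omega) u ψ
  · obtain rfl : p = 0 := by omega
    obtain rfl : k = m := by omega
    obtain rfl : q = k := by omega
    have hw : 0 ≤ ψ ^ (2*(((0:ℕ):ℝ) - γ)) := Real.rpow_nonneg hψ.le _
    have hen : ∀ j, ENNReal.ofReal (ψ ^ (2*(((0:ℕ):ℝ) - γ))) *
        ∫⁻ t in Ioc (0:ℝ) (2*π), ENNReal.ofReal (‖iteratedDeriv j (u ψ) t‖^2) =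
        angularEnergy γ 0 j u ψ := by
      intro j
      unfold angularEnergy
      rw [← lintegral_const_mul' _ _ ENNReal.ofReal_ne_top]
      simp_rw [ENNReal.ofReal_mul hw]
      simp [pder]
    have hsup : ∀ θ ∈ Ioc (0:ℝ) (2*π),
        ENNReal.ofReal (ψ ^ (2*(((0:ℕ):ℝ) - γ)) * ‖pder 0 (q-q) u ψ θ‖^2) ≤
          4 * totalEnergy γ q u ψ := by
      intro θ hθ
      have h := ofReal_sq_norm_le_sobolev
        ((hu.contDiff_slice_snd hψ).of_le (mod_cast le_top)) hθ
      calc _ = ENNReal.ofReal (ψ ^ (2*(((0:ℕ):ℝ) - γ))) * ENNReal.ofReal (‖u ψ θ‖^2) := by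
            rw [ENNReal.ofReal_mul hw]
            simp [pder]
        _ ≤ ENNReal.ofReal (ψ ^ (2*(((0:ℕ):ℝ) - γ))) * _ := mul_le_mul_right h _
        _ = 2 * (angularEnergy γ 0 0 u ψ + angularEnergy γ 0 1 u ψ) := by
            rw [← hen 0, ← hen 1, iteratedDeriv_one, iteratedDeriv_zero]
            ring
        _ ≤ 2 * (totalEnergy γ q u ψ + totalEnergy γ q u ψ) := by
            gcongr
            · exact angularEnergy_le_totalEnergy γ (by omega) u ψ
            · exact angularEnergy_le_totalEnergy γ (by omega) u ψ
        _ = 4 * totalEnergy γ q u ψ := by ring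
    have hmeas : Measurable fun θ => ENNReal.ofReal (‖iteratedDeriv q ξ θ‖^2) := by
      have := (hξ.continuous_iteratedDeriv q (mod_cast le_top)).measurable
      fun_prop
    calc _ ≤ ∫⁻ θ in Ioc (0:ℝ) (2*π), ENNReal.ofReal (‖iteratedDeriv q ξ θ‖^2) *
          (4 * totalEnergy γ q u ψ) :=
          setLIntegral_mono' measurableSet_Ioc fun θ hθ => by gcongr; exact hsup θ hθ
      _ = (∫⁻ θ in Ioc (0:ℝ) (2*π), ENNReal.ofReal (‖iteratedDeriv q ξ θ‖^2)) *
          (4 * totalEnergy γ q u ψ) := lintegral_mul_const _ hmeas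
      _ ≤ HNormSq q ξ * (4 * totalEnergy γ q u ψ) := by
          gcongr; exact lintegral_le_HNormSq le_rfl ξ
      _ = _ := by ring

lemma ofReal_sq_pder_mul_le {m : ℕ} {ξ : ℝ → ℂ} (hξ : ContDiff ℝ (⊤ : ℕ∞) ξ) {u : ℝ → ℝ → ℂ}
    (hu : ContDiffOn ℝ (⊤ : ℕ∞) (Function.uncurry u) (Ioi (0:ℝ) ×ˢ (univ : Set ℝ)))
    (p : ℕ) {q : ℕ} (hq : q ≤ m) {ψ : ℝ} (hψ : 0 < ψ) (θ : ℝ) {w : ℝ} (hw : 0 ≤ w) :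
    ENNReal.ofReal (w * ‖pder p q (fun ψ θ => ξ θ * u ψ θ) ψ θ‖^2) ≤
      ∑ k ∈ Finset.range (q+1), ((m+1) * 4^m : ℕ) *
        (ENNReal.ofReal (‖iteratedDeriv k ξ θ‖^2) *
          ENNReal.ofReal (w * ‖pder p (q-k) u ψ θ‖^2)) := by
  have hterm : ∀ k ∈ Finset.range (q+1),
      ‖(q.choose k * iteratedDeriv k ξ θ) * pder p (q-k) u ψ θ‖^2 ≤
        4^m * (‖iteratedDeriv k ξ θ‖^2 * ‖pder p (q-k) u ψ θ‖^2) := by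
    intro k _
    have hch : (q.choose k : ℝ) ≤ 2^m := by
      exact_mod_cast (Nat.choose_le_two_pow q k).trans (Nat.pow_le_pow_right (by norm_num) hq)
    have hch2 : (q.choose k : ℝ)^2 ≤ 4^m := by
      calc (q.choose k : ℝ)^2 ≤ (2^m)^2 := by gcongr
        _ = 4^m := by rw [← pow_mul, mul_comm, pow_mul]; norm_num
    simp only [norm_mul, mul_pow, Complex.norm_natCast]
    rw [mul_assoc]
    gcongr
  have hreal : w * ‖pder p q (fun ψ θ => ξ θ * u ψ θ) ψ θ‖^2 ≤
      ∑ k ∈ Finset.range (q+1), (((m+1) * 4^m : ℕ) : ℝ) *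
        (‖iteratedDeriv k ξ θ‖^2 * (w * ‖pder p (q-k) u ψ θ‖^2)) := by
    rw [pder_mul hξ hu p q hψ θ]
    calc _ ≤ w * (∑ k ∈ Finset.range (q+1),
          ‖(q.choose k * iteratedDeriv k ξ θ) * pder p (q-k) u ψ θ‖)^2 := by
          gcongr
          exact norm_sum_le _ _
      _ ≤ w * ((Finset.range (q+1)).card * ∑ k ∈ Finset.range (q+1),
          ‖(q.choose k * iteratedDeriv k ξ θ) * pder p (q-k) u ψ θ‖^2) := by
          gcongr
          exact sq_sum_le_card_mul_sum_sq
      _ ≤ w * ((m+1 : ℝ) * ∑ k ∈ Finset.range (q+1),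
          4^m * (‖iteratedDeriv k ξ θ‖^2 * ‖pder p (q-k) u ψ θ‖^2)) := by
          gcongr with k hk
          · rw [Finset.card_range]
            exact_mod_cast Nat.succ_le_succ hq
          · exact hterm k hk
      _ = _ := by
          rw [Finset.mul_sum, Finset.mul_sum]
          refine Finset.sum_congr rfl fun k _ => ?_
          push_cast
          ring
  refine (ENNReal.ofReal_le_ofReal hreal).trans_eq ?_
  rw [ENNReal.ofReal_sum_of_nonneg fun k _ => by positivity]
  refine Finset.sum_congr rfl fun k _ => ?_
  rw [ENNReal.ofReal_mul (by positivity), ENNReal.ofReal_mul (by positivity),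
    ENNReal.ofReal_natCast]

lemma angularEnergy_mul_le {m : ℕ} (hm : 1 ≤ m) (γ : ℝ) {ξ : ℝ → ℂ}
    (hξ : ContDiff ℝ (⊤ : ℕ∞) ξ) {u : ℝ → ℝ → ℂ}
    (hu : ContDiffOn ℝ (⊤ : ℕ∞) (Function.uncurry u) (Ioi (0:ℝ) ×ˢ (univ : Set ℝ)))
    {p q : ℕ} (hpq : p + q ≤ m) {ψ : ℝ} (hψ : 0 < ψ) :
    angularEnergy γ p q (fun ψ θ => ξ θ * u ψ θ) ψ ≤
      ((m+1) * ((m+1) * 4^m * 4) : ℕ) * HNormSq m ξ * totalEnergy γ m u ψ := by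
  have hmeas : ∀ k, Measurable fun θ => ((m+1) * 4^m : ℕ) *
        (ENNReal.ofReal (‖iteratedDeriv k ξ θ‖^2) *
          ENNReal.ofReal (ψ ^ (2*((p:ℝ) - γ)) * ‖pder p (q-k) u ψ θ‖^2)) := by
    intro k
    have h1 := (hξ.continuous_iteratedDeriv k (mod_cast le_top)).measurable
    have h2 := ((contDiffOn_pder hu p (q-k)).contDiff_slice_snd hψ).continuous.measurable
    fun_prop
  calc _ ≤ ∫⁻ θ in Ioc (0:ℝ) (2*π), ∑ k ∈ Finset.range (q+1), ((m+1) * 4^m : ℕ) *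
        (ENNReal.ofReal (‖iteratedDeriv k ξ θ‖^2) *
          ENNReal.ofReal (ψ ^ (2*((p:ℝ) - γ)) * ‖pder p (q-k) u ψ θ‖^2)) :=
        lintegral_mono fun θ => ofReal_sq_pder_mul_le hξ hu p (by omega) hψ θ
          (Real.rpow_nonneg hψ.le _)
    _ = ∑ k ∈ Finset.range (q+1), ((m+1) * 4^m : ℕ) * ∫⁻ θ in Ioc (0:ℝ) (2*π),
        (ENNReal.ofReal (‖iteratedDeriv k ξ θ‖^2) *
          ENNReal.ofReal (ψ ^ (2*((p:ℝ) - γ)) * ‖pder p (q-k) u ψ θ‖^2)) := by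
        rw [lintegral_finsetSum _ fun k _ => hmeas k]
        exact Finset.sum_congr rfl fun k _ => lintegral_const_mul' _ _ (ENNReal.natCast_ne_top _)
    _ ≤ ∑ _k ∈ Finset.range (q+1), ((m+1) * 4^m : ℕ) *
        (4 * HNormSq m ξ * totalEnergy γ m u ψ) := by
        gcongr with k hk
        exact lintegral_leibniz_term_le hm γ hξ hu hpq
          (Nat.lt_succ_iff.1 (Finset.mem_range.1 hk)) hψ
    _ = (q+1 : ℕ) * (((m+1) * 4^m : ℕ) * (4 * HNormSq m ξ * totalEnergy γ m u ψ)) := by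
        rw [Finset.sum_const, Finset.card_range, nsmul_eq_mul]
    _ ≤ (m+1 : ℕ) * (((m+1) * 4^m : ℕ) * (4 * HNormSq m ξ * totalEnergy γ m u ψ)) := by
        gcongr
        omega
    _ = _ := by push_cast; ring

lemma KNormSq_mul_le {m : ℕ} (hm : 1 ≤ m) (γ : ℝ) {ξ : ℝ → ℂ}
    (hξ : ContDiff ℝ (⊤ : ℕ∞) ξ) {u : ℝ → ℝ → ℂ}
    (hu : ContDiffOn ℝ (⊤ : ℕ∞) (Function.uncurry u) (Ioi (0:ℝ) ×ˢ (univ : Set ℝ))) :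
    KNormSq γ m (fun ψ θ => ξ θ * u ψ θ) ≤
      ((m+1) * ((m+1) * ((m+1) * ((m+1) * 4^m * 4))) : ℕ) * HNormSq m ξ * KNormSq γ m u := by
  set K : ℕ := (m+1) * ((m+1) * 4^m * 4)
  have hterm : ∀ p ∈ Finset.range (m+1), ∀ q ∈ Finset.range (m+1-p),
      ∫⁻ ψ in Ioc (0:ℝ) 1, angularEnergy γ p q (fun ψ θ => ξ θ * u ψ θ) ψ ≤
        K * HNormSq m ξ * KNormSq γ m u := by
    intro p hp q hq
    rw [Finset.mem_range] at hp hq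
    calc _ ≤ ∫⁻ ψ in Ioc (0:ℝ) 1, K * HNormSq m ξ * totalEnergy γ m u ψ :=
          setLIntegral_mono' measurableSet_Ioc fun ψ hψ =>
            angularEnergy_mul_le hm γ hξ hu (by omega) hψ.1
      _ = K * HNormSq m ξ * ∫⁻ ψ in Ioc (0:ℝ) 1, totalEnergy γ m u ψ :=
          lintegral_const_mul' _ _
            (ENNReal.mul_ne_top (ENNReal.natCast_ne_top _) (HNormSq_ne_top m hξ))
      _ = _ := by rw [lintegral_totalEnergy γ m hu]
  calc _ ≤ ∑ p ∈ Finset.range (m+1), ∑ _q ∈ Finset.range (m+1-p),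
        (K * HNormSq m ξ * KNormSq γ m u) :=
        Finset.sum_le_sum fun p hp => Finset.sum_le_sum fun q hq => hterm p hp q hq
    _ ≤ ∑ _p ∈ Finset.range (m+1), ((m+1 : ℕ) * (K * HNormSq m ξ * KNormSq γ m u)) := by
        refine Finset.sum_le_sum fun p _ => ?_
        rw [Finset.sum_const, Finset.card_range, nsmul_eq_mul]
        gcongr
        omega
    _ = _ := by
        rw [Finset.sum_const, Finset.card_range, nsmul_eq_mul]
        push_cast
        ring

/-- **Multiplication of `K_γ^m(Π)` by `H^m(𝕋)` functions** for `m ≥ 1`: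
`‖ξ u‖_{K_γ^m} ≤ C ‖ξ‖_{H^m(𝕋)} ‖u‖_{K_γ^m}`. -/
theorem sobolev_mul_kondratev (m : ℕ) (hm : 1 ≤ m) (γ : ℝ) :
    ∃ C > 0, ∀ ξ : ℝ → ℂ, ContDiff ℝ (⊤ : ℕ∞) ξ → (∀ θ, ξ (θ + 2*π) = ξ θ) →
      ∀ u : ℝ → ℝ → ℂ, SmoothAnn u → KNorm γ m u ≠ ⊤ →
      KNorm γ m (fun ψ θ => ξ θ * u ψ θ) ≤
        ENNReal.ofReal C * HNormC m ξ * KNorm γ m u := by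
  set K : ℕ := (m+1) * ((m+1) * ((m+1) * ((m+1) * 4^m * 4)))
  have hKpos : 0 < (K : ℝ) := by positivity
  refine ⟨(K : ℝ) ^ ((1:ℝ)/2), Real.rpow_pos_of_pos hKpos _, fun ξ hξ _ u hu _ => ?_⟩
  rw [← ENNReal.ofReal_rpow_of_pos hKpos, ENNReal.ofReal_natCast]
  change KNormSq γ m _ ^ ((1:ℝ)/2) ≤
    (K : ℝ≥0∞) ^ ((1:ℝ)/2) * HNormSq m ξ ^ ((1:ℝ)/2) * KNormSq γ m u ^ ((1:ℝ)/2)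
  rw [← ENNReal.mul_rpow_of_nonneg _ _ (by norm_num), ← ENNReal.mul_rpow_of_nonneg _ _ (by norm_num)]
  exact ENNReal.rpow_le_rpow (KNormSq_mul_le hm γ hξ hu.1) (by norm_num)
end
end

section
/- Let m ≥ 1 be an integer. There exists a constant C > 0 depending only on m such that for every function f : ℝ → ℝ of class C^m with ‖f‖_{C^m} = max_{0 ≤ j ≤ m} sup_ℝ |f^{(j)}| < ∞, and every smooth function u : 𝕋 → ℝ, one has ‖f ∘ u‖_{H^m(𝕋)} ≤ C ‖f‖_{C^m} (1 + ‖u‖_{H^m(𝕋)}^m). -/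
open MeasureTheory Real Set ENNReal

noncomputable section

/-- The Sobolev norm `‖ξ‖_{H^m(𝕋)}` of a real-valued function on the circle:
`‖ξ‖²_{H^m} = Σ_{q=0}^m ∫_𝕋 |D^q ξ|² dθ`. -/
def HNormR (m : ℕ) (ξ : ℝ → ℝ) : ℝ≥0∞ :=
  (∑ q ∈ Finset.range (m+1), ∫⁻ θ in Ioc (0:ℝ) (2*π),
    ENNReal.ofReal (|iteratedDeriv q ξ θ|^2)) ^ ((1:ℝ)/2)

/-- The squared `H^m` norm on the circle as a real number. -/
def sobolevSq (m : ℕ) (ξ : ℝ → ℝ) : ℝ :=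
  ∑ q ∈ Finset.range (m + 1), ∫ θ in (0 : ℝ)..(2 * π), (iteratedDeriv q ξ θ) ^ 2

lemma integral_iteratedDeriv_sq_nonneg (q : ℕ) (ξ : ℝ → ℝ) :
    0 ≤ ∫ θ in (0 : ℝ)..(2 * π), (iteratedDeriv q ξ θ) ^ 2 :=
  intervalIntegral.integral_nonneg two_pi_pos.le fun _ _ => sq_nonneg _

lemma sobolevSq_nonneg (m : ℕ) (ξ : ℝ → ℝ) : 0 ≤ sobolevSq m ξ :=
  Finset.sum_nonneg fun q _ => integral_iteratedDeriv_sq_nonneg q ξ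

lemma HNormR_eq_ofReal_sqrt {m : ℕ} {ξ : ℝ → ℝ} (hξ : ContDiff ℝ (m : ℕ∞) ξ) :
    HNormR m ξ = ENNReal.ofReal (√(sobolevSq m ξ)) := by
  have key : ∀ q ∈ Finset.range (m + 1),
      ∫⁻ θ in Ioc (0 : ℝ) (2 * π), ENNReal.ofReal (|iteratedDeriv q ξ θ| ^ 2) =
        ENNReal.ofReal (∫ θ in (0 : ℝ)..(2 * π), (iteratedDeriv q ξ θ) ^ 2) := by
    intro q hq
    have hq' : q ≤ m := by simpa [Nat.lt_succ_iff] using hq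
    have hc : Continuous (iteratedDeriv q ξ) :=
      hξ.continuous_iteratedDeriv q (by exact_mod_cast hq')
    simp_rw [sq_abs]
    rw [intervalIntegral.integral_of_le two_pi_pos.le, ofReal_integral_eq_lintegral_ofReal]
    · exact ((hc.pow 2).intervalIntegrable 0 (2 * π)).1
    · exact Filter.Eventually.of_forall fun _ => sq_nonneg _
  rw [HNormR, Finset.sum_congr rfl key,
    ← ENNReal.ofReal_sum_of_nonneg fun q _ => integral_iteratedDeriv_sq_nonneg q ξ,
    Real.sqrt_eq_rpow]
  exact ENNReal.ofReal_rpow_of_nonneg (sobolevSq_nonneg m ξ) (by norm_num)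

/-- The one-dimensional Sobolev embedding `H¹ ⊂ L^∞` on `[0, 2π]`. -/
lemma sq_le_two_mul_integral_sq_add {g g' : ℝ → ℝ} (hg : ∀ x, HasDerivAt g (g' x) x)
    (hg' : Continuous g') {θ : ℝ} (hθ : θ ∈ Icc 0 (2 * π)) :
    g θ ^ 2 ≤ 2 * ((∫ x in (0 : ℝ)..(2 * π), g x ^ 2) + ∫ x in (0 : ℝ)..(2 * π), g' x ^ 2) := by
  have hgc : Continuous g := continuous_iff_continuousAt.2 fun x => (hg x).continuousAt
  have hπ : (1 : ℝ) ≤ 2 * π := by linarith [pi_gt_three]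
  have hi : ∀ a b, IntervalIntegrable (fun x => g x ^ 2) volume a b :=
    fun a b => (hgc.pow 2).intervalIntegrable a b
  have hi' : ∀ a b, IntervalIntegrable (fun x => g' x ^ 2) volume a b :=
    fun a b => (hg'.pow 2).intervalIntegrable a b
  have h0 : 0 ≤ ∫ x in (0 : ℝ)..(2 * π), g x ^ 2 :=
    intervalIntegral.integral_nonneg two_pi_pos.le fun _ _ => sq_nonneg _
  have h0' : 0 ≤ ∫ x in (0 : ℝ)..(2 * π), g' x ^ 2 :=
    intervalIntegral.integral_nonneg two_pi_pos.le fun _ _ => sq_nonneg _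
  set A := (∫ x in (0 : ℝ)..(2 * π), g x ^ 2) + ∫ x in (0 : ℝ)..(2 * π), g' x ^ 2 with hA
  have hcont : Continuous fun x => g x ^ 2 + g' x ^ 2 := by fun_prop
  have hdiff : ∀ s ∈ Icc 0 (2 * π), g θ ^ 2 - g s ^ 2 ≤ A := by
    intro s hs
    have hd : ∫ x in s..θ, 2 * g x * g' x = g θ ^ 2 - g s ^ 2 := by
      refine intervalIntegral.integral_eq_sub_of_hasDerivAt (f := fun x => g x ^ 2)
        (fun x _ => ?_) (Continuous.intervalIntegrable (by fun_prop) _ _)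
      have := (hg x).fun_pow 2
      simpa using this
    rw [← hd]
    calc ∫ x in s..θ, 2 * g x * g' x ≤ ‖∫ x in s..θ, 2 * g x * g' x‖ := le_abs_self _
      _ ≤ ∫ x in Set.uIoc s θ, ‖2 * g x * g' x‖ := intervalIntegral.norm_integral_le_integral_norm_uIoc
      _ ≤ ∫ x in Set.uIoc s θ, (g x ^ 2 + g' x ^ 2) := by
          refine setIntegral_mono ?_ ?_ fun x => ?_
          · exact (Continuous.intervalIntegrable (u := fun x => ‖2 * g x * g' x‖) (by fun_prop) s θ).def'
          · exact (hcont.intervalIntegrable s θ).def'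
          · rw [Real.norm_eq_abs, abs_le]
            constructor <;> nlinarith [sq_nonneg (g x + g' x), sq_nonneg (g x - g' x)]
      _ ≤ ∫ x in Ioc 0 (2 * π), (g x ^ 2 + g' x ^ 2) := by
          refine setIntegral_mono_set (hcont.intervalIntegrable 0 (2 * π)).1
            (Filter.Eventually.of_forall fun x => by positivity)
            (LE.le.eventuallyLE ?_)
          exact Ioc_subset_Ioc (le_min hs.1 hθ.1) (max_le hs.2 hθ.2)
      _ = A := by
          rw [← intervalIntegral.integral_of_le two_pi_pos.le,
            intervalIntegral.integral_add (hi _ _) (hi' _ _)]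
  have hmono : ∫ s in (0 : ℝ)..(2 * π), (g θ ^ 2 - A) ≤ ∫ s in (0 : ℝ)..(2 * π), g s ^ 2 :=
    intervalIntegral.integral_mono_on two_pi_pos.le (by simp) (hi _ _)
      fun s hs => by linarith [hdiff s hs]
  rw [intervalIntegral.integral_const, smul_eq_mul, sub_zero] at hmono
  by_contra! hlt
  nlinarith

lemma abs_iteratedDeriv_le_of_lt {m i : ℕ} (hi : i < m) {u : ℝ → ℝ}
    (hu : ContDiff ℝ (m : ℕ∞) u) {θ : ℝ} (hθ : θ ∈ Icc 0 (2 * π)) :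
    |iteratedDeriv i u θ| ≤ 2 * √(sobolevSq m u) := by
  have hd : ∀ x, HasDerivAt (iteratedDeriv i u) (iteratedDeriv (i + 1) u x) x := fun x => by
    rw [iteratedDeriv_succ]
    exact (hu.differentiable_iteratedDeriv i (by exact_mod_cast hi) x).hasDerivAt
  have h1 := sq_le_two_mul_integral_sq_add hd
    (hu.continuous_iteratedDeriv (i + 1) (by exact_mod_cast hi)) hθ
  have h2 : (∫ x in (0 : ℝ)..(2 * π), iteratedDeriv i u x ^ 2) +
      ∫ x in (0 : ℝ)..(2 * π), iteratedDeriv (i + 1) u x ^ 2 ≤ sobolevSq m u := by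
    rw [← Finset.sum_pair (f := fun q => ∫ x in (0 : ℝ)..(2 * π), iteratedDeriv q u x ^ 2)
      (Nat.succ_ne_self i).symm]
    refine Finset.sum_le_sum_of_subset_of_nonneg ?_
      fun q _ _ => integral_iteratedDeriv_sq_nonneg q u
    intro q hq
    simp only [Finset.mem_insert, Finset.mem_singleton, Finset.mem_range] at hq ⊢
    omega
  have h0 := sobolevSq_nonneg m u
  refine abs_le_of_sq_le_sq ?_ (by positivity)
  rw [mul_pow, Real.sq_sqrt h0]
  linarith

lemma one_add_two_mul_pow_le {N : ℝ} (hN : 0 ≤ N) (m : ℕ) :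
    (1 + 2 * N) ^ m ≤ 3 ^ m * (1 + N ^ m) := by
  rcases le_total N 1 with h | h
  · calc (1 + 2 * N) ^ m ≤ 3 ^ m := by gcongr; linarith
      _ ≤ 3 ^ m * (1 + N ^ m) := le_mul_of_one_le_right (by positivity) (by linarith [pow_nonneg hN m])
  · calc (1 + 2 * N) ^ m ≤ (3 * N) ^ m := by gcongr; linarith
      _ ≤ 3 ^ m * (1 + N ^ m) := by rw [mul_pow]; gcongr; linarith

/-- Pointwise chain rule estimate, linear in the top order derivative of `u`. -/
lemma abs_iteratedDeriv_comp_le {m q : ℕ} (hm : 1 ≤ m) (hq : q ≤ m) {f u : ℝ → ℝ} {M B θ : ℝ}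
    (hf : ContDiff ℝ (m : ℕ∞) f) (hu : ContDiff ℝ (m : ℕ∞) u)
    (hfM : ∀ j ≤ m, |iteratedDeriv j f (u θ)| ≤ M) (hB : 0 ≤ B)
    (huB : ∀ i < m, |iteratedDeriv i u θ| ≤ B) :
    |iteratedDeriv q (fun x => f (u x)) θ| ≤
      m.factorial * M * ((1 + B) ^ m + |iteratedDeriv m u θ|) := by
  have hM : 0 ≤ M := (abs_nonneg _).trans (hfM 0 (Nat.zero_le m))
  set T := |iteratedDeriv m u θ| with hT
  have hT0 : 0 ≤ T := abs_nonneg _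
  set R := T ^ ((m : ℝ)⁻¹) with hR
  have hR0 : 0 ≤ R := by positivity
  have hRm : R ^ m = T := Real.rpow_inv_natCast_pow hT0 (by omega)
  set D := max (1 + B) R with hD
  have hD1 : 1 ≤ D := le_max_of_le_left (by linarith)
  have hDm : D ^ m ≤ (1 + B) ^ m + T := by
    rcases max_choice (1 + B) R with h | h
    · rw [hD, h]; linarith
    · rw [hD, h, hRm]; linarith [pow_nonneg (by linarith : (0 : ℝ) ≤ 1 + B) m]
  have h := norm_iteratedFDeriv_comp_le (n := q) (C := M) (D := D) hf hu
    (by exact_mod_cast hq) θ ?_ ?_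
  · rw [norm_iteratedFDeriv_eq_norm_iteratedDeriv, Real.norm_eq_abs] at h
    refine h.trans ?_
    have hq1 : (q.factorial : ℝ) ≤ m.factorial := by exact_mod_cast Nat.factorial_le hq
    have hq2 : D ^ q ≤ D ^ m := pow_le_pow_right₀ hD1 hq
    gcongr
    exact hq2.trans hDm
  · intro i hi
    rw [norm_iteratedFDeriv_eq_norm_iteratedDeriv]
    exact hfM i (hi.trans hq)
  · intro i hi1 hi
    rw [norm_iteratedFDeriv_eq_norm_iteratedDeriv, Real.norm_eq_abs]
    rcases (hi.trans hq).lt_or_eq with hlt | rfl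
    · calc |iteratedDeriv i u θ| ≤ 1 + B := by linarith [huB i hlt]
        _ ≤ D := le_max_left _ _
        _ ≤ D ^ i := le_self_pow₀ hD1 (by omega)
    · calc |iteratedDeriv i u θ| = R ^ i := hRm.symm
        _ ≤ D ^ i := by gcongr; exact le_max_right _ _

lemma sobolevSq_comp_le {m : ℕ} (hm : 1 ≤ m) {f u : ℝ → ℝ} {M : ℝ}
    (hf : ContDiff ℝ (m : ℕ∞) f) (hu : ContDiff ℝ (m : ℕ∞) u)
    (hfM : ∀ j ≤ m, ∀ x : ℝ, |iteratedDeriv j f x| ≤ M) :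
    sobolevSq m (fun x => f (u x)) ≤
      (m + 1) * (2 * (m.factorial * M) ^ 2 * ((16 * 9 ^ m + 1) *
        (1 + √(sobolevSq m u) ^ m) ^ 2)) := by
  set N := √(sobolevSq m u) with hN
  have hN0 : 0 ≤ N := Real.sqrt_nonneg _
  have hN2 : N ^ 2 = sobolevSq m u := Real.sq_sqrt (sobolevSq_nonneg m u)
  have hfu : ContDiff ℝ (m : ℕ∞) (fun x => f (u x)) := hf.comp hu
  set K := (1 + 2 * N) ^ m with hK
  have hK0 : 0 ≤ K := by positivity
  set F := m.factorial * M with hF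
  have hM : 0 ≤ M := (abs_nonneg _).trans (hfM 0 (Nat.zero_le m) 0)
  have hF0 : 0 ≤ F := by positivity
  have hcu : Continuous (iteratedDeriv m u) := hu.continuous_iteratedDeriv m le_rfl
  have htop : ∫ θ in (0 : ℝ)..(2 * π), iteratedDeriv m u θ ^ 2 ≤ N ^ 2 := by
    rw [hN2]
    exact Finset.single_le_sum
      (f := fun q => ∫ θ in (0 : ℝ)..(2 * π), iteratedDeriv q u θ ^ 2)
      (fun q _ => integral_iteratedDeriv_sq_nonneg q u) (Finset.self_mem_range_succ m)
  have hNm : N ^ 2 ≤ (1 + N ^ m) ^ 2 := by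
    refine pow_le_pow_left₀ hN0 ?_ 2
    rcases le_total N 1 with h | h
    · linarith [pow_nonneg hN0 m]
    · linarith [le_self_pow₀ h (by omega : m ≠ 0)]
  have hKm : K ^ 2 ≤ 9 ^ m * (1 + N ^ m) ^ 2 := by
    calc K ^ 2 ≤ (3 ^ m * (1 + N ^ m)) ^ 2 :=
          pow_le_pow_left₀ hK0 (one_add_two_mul_pow_le hN0 m) 2
      _ = 9 ^ m * (1 + N ^ m) ^ 2 := by rw [mul_pow, ← pow_mul, mul_comm m 2, pow_mul]; norm_num
  have hterm : ∀ q ∈ Finset.range (m + 1),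
      ∫ θ in (0 : ℝ)..(2 * π), iteratedDeriv q (fun x => f (u x)) θ ^ 2 ≤
        2 * F ^ 2 * ((16 * 9 ^ m + 1) * (1 + N ^ m) ^ 2) := by
    intro q hq
    have hq' : q ≤ m := by simpa [Nat.lt_succ_iff] using hq
    have hcfu := hfu.continuous_iteratedDeriv q (by exact_mod_cast hq')
    calc ∫ θ in (0 : ℝ)..(2 * π), iteratedDeriv q (fun x => f (u x)) θ ^ 2
        ≤ ∫ θ in (0 : ℝ)..(2 * π), 2 * F ^ 2 * (K ^ 2 + iteratedDeriv m u θ ^ 2) := by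
          refine intervalIntegral.integral_mono_on two_pi_pos.le
            ((hcfu.pow 2).intervalIntegrable _ _)
            (Continuous.intervalIntegrable (by fun_prop) _ _) fun θ hθ => ?_
          have h := abs_iteratedDeriv_comp_le hm hq' hf hu (fun j hj => hfM j hj (u θ))
            (by positivity) fun i hi => abs_iteratedDeriv_le_of_lt hi hu hθ
          rw [← sq_abs, ← sq_abs (iteratedDeriv m u θ)]
          calc |iteratedDeriv q (fun x => f (u x)) θ| ^ 2
              ≤ (F * (K + |iteratedDeriv m u θ|)) ^ 2 := pow_le_pow_left₀ (abs_nonneg _) h 2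
            _ = F ^ 2 * (K + |iteratedDeriv m u θ|) ^ 2 := mul_pow _ _ _
            _ ≤ F ^ 2 * (2 * (K ^ 2 + |iteratedDeriv m u θ| ^ 2)) := by
                gcongr
                exact add_sq_le
            _ = _ := by ring
      _ = 2 * F ^ 2 * (2 * π * K ^ 2 + ∫ θ in (0 : ℝ)..(2 * π), iteratedDeriv m u θ ^ 2) := by
          rw [intervalIntegral.integral_const_mul, intervalIntegral.integral_add (by simp)
            (Continuous.intervalIntegrable (by fun_prop) _ _), intervalIntegral.integral_const, smul_eq_mul,
            sub_zero]
      _ ≤ 2 * F ^ 2 * ((16 * 9 ^ m + 1) * (1 + N ^ m) ^ 2) := by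
          gcongr
          nlinarith [pi_le_four, pi_pos, sq_nonneg K]
  refine (Finset.sum_le_sum hterm).trans (le_of_eq ?_)
  rw [Finset.sum_const, Finset.card_range, nsmul_eq_mul]
  push_cast
  ring

/-- **Superposition operators on `H^m(𝕋)`**: for `m ≥ 1` there is `C > 0`,
depending only on `m`, such that for every `f ∈ C^m(ℝ)` with
`‖f‖_{C^m} = max_{j ≤ m} sup |f^(j)| ≤ M` and every smooth `u : 𝕋 → ℝ`,
`‖f ∘ u‖_{H^m(𝕋)} ≤ C ‖f‖_{C^m} (1 + ‖u‖_{H^m(𝕋)}^m)`. -/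
theorem superposition_sobolev_circle (m : ℕ) (hm : 1 ≤ m) :
    ∃ C > 0, ∀ (f : ℝ → ℝ) (M : ℝ), ContDiff ℝ (m : ℕ∞) f →
      (∀ j ≤ m, ∀ x : ℝ, |iteratedDeriv j f x| ≤ M) →
      ∀ u : ℝ → ℝ, ContDiff ℝ (⊤ : ℕ∞) u → (∀ θ, u (θ + 2*π) = u θ) →
      HNormR m (fun θ => f (u θ)) ≤
        ENNReal.ofReal (C * M) * (1 + HNormR m u ^ m) := by
  refine ⟨√((m + 1) * (2 * (m.factorial : ℝ) ^ 2 * (16 * 9 ^ m + 1))), by positivity, ?_⟩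
  intro f M hf hfM u hu _
  have hM : 0 ≤ M := (abs_nonneg _).trans (hfM 0 (Nat.zero_le m) 0)
  have hum : ContDiff ℝ (m : ℕ∞) u := hu.of_le (by exact_mod_cast le_top)
  have hfu : ContDiff ℝ (m : ℕ∞) fun θ => f (u θ) := hf.comp hum
  rw [HNormR_eq_ofReal_sqrt hfu, HNormR_eq_ofReal_sqrt hum, ← ENNReal.ofReal_pow (Real.sqrt_nonneg _), ← ENNReal.ofReal_one,
    ← ENNReal.ofReal_add zero_le_one (by positivity), ← ENNReal.ofReal_mul (by positivity)]
  refine ENNReal.ofReal_le_ofReal (Real.sqrt_le_iff.2 ⟨by positivity, ?_⟩)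
  refine (sobolevSq_comp_le hm hf hum hfM).trans (le_of_eq ?_)
  rw [mul_pow _ (1 + _), mul_pow √_, Real.sq_sqrt (by positivity)]
  ring
end
end
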